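/- arXiv:1104.5472 — 2 statements merged into one kernel-verified Lean document; each statement's English description precedes it below -/
import Mathlib

section
/- Let μ be an inner involution of g. Then there exist commuting involutions of maximal rank ϑ and ϑ' of g such that μ = ϑ∘ϑ'. -/
open LieAlgebra Module

variable (k : Type*) [Field k] [IsAlgClosed k] [CharZero k]
variable (g : Type*) [LieRing g] [LieAlgebra k g] [FiniteDimensional k g]
  [LieAlgebra.IsSemisimple k g]

/-- The eigenspace of a Lie algebra automorphism `σ` for the eigenvalue `c`. -/
noncomputable def eigSub (σ : g ≃ₗ⁅k⁆ g) (c : k) : Submodule k g :=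
  Module.End.eigenspace (σ.toLinearEquiv : g →ₗ[k] g) c

/-- A Lie algebra involution: an automorphism `σ` with `σ ∘ σ = id`. -/
def IsInvolution (σ : g ≃ₗ⁅k⁆ g) : Prop := ∀ x, σ (σ x) = x

/-- Two commuting involutions. -/
def CommutingInvolutions (σ₁ σ₂ : g ≃ₗ⁅k⁆ g) : Prop :=
  IsInvolution k g σ₁ ∧ IsInvolution k g σ₂ ∧ ∀ x, σ₁ (σ₂ x) = σ₂ (σ₁ x)

/-- The subspace `g_{ij}` of the quaternionic decomposition determined by commuting
involutions `σ₁, σ₂`: here `i, j : Bool` and `false, true` encode the exponents `0, 1`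
of the eigenvalues `(-1)^i`, `(-1)^j`. -/
noncomputable def qSpace (σ₁ σ₂ : g ≃ₗ⁅k⁆ g) (i j : Bool) : Submodule k g :=
  eigSub k g σ₁ (if i then -1 else 1) ⊓ eigSub k g σ₂ (if j then -1 else 1)

/-- `x` is a semisimple element of `g`: `ad x` is a semisimple endomorphism. -/
def IsSSElt (x : g) : Prop := Module.End.IsSemisimple (ad k g x)

/-- `x` is a nilpotent element of `g`: `ad x` is a nilpotent endomorphism. -/
def IsNilpElt (x : g) : Prop := IsNilpotent (ad k g x)

/-- `x` is a regular element of `g`: the dimension of its centralizer equals the rank of `g`,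
i.e. the dimension of a Cartan subalgebra of `g`. -/
def IsRegElt (x : g) : Prop :=
  ∃ H : LieSubalgebra k g, H.IsCartanSubalgebra ∧
    Module.finrank k (LinearMap.ker (ad k g x)) = Module.finrank k H

/-- An involution is of maximal rank if its `(-1)`-eigenspace contains a Cartan
subalgebra of `g`. -/
def IsMaxRank (σ : g ≃ₗ⁅k⁆ g) : Prop :=
  ∃ H : LieSubalgebra k g, H.IsCartanSubalgebra ∧ H.toSubmodule ≤ eigSub k g σ (-1)

/-- The centralizer of an element `x`, as a Lie subalgebra of `g`. -/
def zg (x : g) : LieSubalgebra k g where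
  carrier := {y | ⁅x, y⁆ = 0}
  add_mem' := by
    intro a b ha hb
    simp only [Set.mem_setOf_eq] at *
    rw [lie_add, ha, hb, add_zero]
  zero_mem' := by simp
  smul_mem' := by
    intro t a ha
    simp only [Set.mem_setOf_eq] at *
    rw [lie_smul, ha, smul_zero]
  lie_mem' := by
    intro a b ha hb
    simp only [Set.mem_setOf_eq] at *
    rw [leibniz_lie, ha, hb, lie_zero, zero_lie, add_zero]

/-- The fixed-point subalgebra of a Lie algebra automorphism. -/
def fixSubalgebra (σ : g ≃ₗ⁅k⁆ g) : LieSubalgebra k g where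
  carrier := {x | σ x = x}
  add_mem' := by
    intro a b ha hb
    simp only [Set.mem_setOf_eq] at *
    rw [show σ (a + b) = σ a + σ b from σ.toLieHom.map_add a b, ha, hb]
  zero_mem' := by simp only [Set.mem_setOf_eq]; exact σ.toLieHom.map_zero
  smul_mem' := by
    intro t a ha
    simp only [Set.mem_setOf_eq] at *
    rw [show σ (t • a) = t • σ a from σ.toLieHom.map_smul t a, ha]
  lie_mem' := by
    intro a b ha hb
    simp only [Set.mem_setOf_eq] at *
    rw [LieEquiv.map_lie σ a b, ha, hb]

/-- The exponential of an endomorphism, as a finite sum (which is the genuine exponential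
when the endomorphism is nilpotent). -/
noncomputable def expEnd (f : Module.End k g) : Module.End k g :=
  ∑ i ∈ Finset.range (Module.finrank k g + 1), (i.factorial : k)⁻¹ • f ^ i

/-- An automorphism of `g` is inner if it lies in the subgroup of automorphisms generated
by the exponentials `exp (ad x)` with `ad x` nilpotent. -/
noncomputable def IsInnerAut (μ : g ≃ₗ⁅k⁆ g) : Prop :=
  μ.toLinearEquiv ∈ Subgroup.closure
    {e : g ≃ₗ[k] g | ∃ x : g, IsNilpotent (ad k g x) ∧
      (e : g →ₗ[k] g) = expEnd k g (ad k g x)}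

/-- `σ` and `τ` are conjugate by an inner automorphism of `g`. -/
noncomputable def InnerConj (σ τ : g ≃ₗ⁅k⁆ g) : Prop :=
  ∃ φ : g ≃ₗ⁅k⁆ g, IsInnerAut k g φ ∧ ∀ x, τ x = φ (σ (φ.symm x))

/-- A dyad: a pair of distinct commuting involutions that are conjugate by an inner
automorphism of `g`. -/
noncomputable def IsDyad (σ₁ σ₂ : g ≃ₗ⁅k⁆ g) : Prop :=
  IsInvolution k g σ₁ ∧ IsInvolution k g σ₂ ∧ σ₁ ≠ σ₂ ∧
    (∀ x, σ₁ (σ₂ x) = σ₂ (σ₁ x)) ∧ InnerConj k g σ₁ σ₂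

/-- The span of all brackets `⁅x, y⁆` with `x, y` in a subspace `m`. -/
noncomputable def bracketSpan (m : Submodule k g) : Submodule k g :=
  Submodule.span k {z | ∃ x ∈ m, ∃ y ∈ m, z = ⁅x, y⁆}

/-- `c` is a Cartan subspace of a subspace `m ⊆ g`: it consists of pairwise commuting
semisimple elements of `g` and is maximal among such subspaces of `m`. -/
def IsCartanSubspace (m c : Submodule k g) : Prop :=
  c ≤ m ∧ (∀ x ∈ c, IsSSElt k g x) ∧ (∀ x ∈ c, ∀ y ∈ c, ⁅x, y⁆ = 0) ∧
    ∀ c' : Submodule k g, c' ≤ m → (∀ x ∈ c', IsSSElt k g x) →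
      (∀ x ∈ c', ∀ y ∈ c', ⁅x, y⁆ = 0) → c ≤ c' → c' = c

section helpers
open LieModule LieAlgebra.IsKilling
set_option linter.all false
section partD
variable {K L : Type*} [Field K] [CharZero K] [IsAlgClosed K] [LieRing L] [LieAlgebra K L]
  [FiniteDimensional K L]

theorem pd_sl2 {h e f : L} (t : IsSl2Triple h e f) (hn : IsNilpotent (ad K L e)) {x y : L} {l : K}
    (hx : x ≠ 0) (hy : y ≠ 0) (hhx : ⁅h, x⁆ = l • x) (hhy : ⁅h, y⁆ = (l + 2) • y)
    (hc : ∀ m : ℕ, ∃ c : K, ((ad K L f) ^ (m+1)) (((ad K L e)^m) y) = c • x) : ⁅e, x⁆ ≠ 0 := by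
  intro hex
  have Px : t.HasPrimitiveVectorWith x l := ⟨hx, hhx, hex⟩
  obtain ⟨n, rfl⟩ := Px.exists_nat
  have hw : ∀ m : ℕ, ⁅h, ((ad K L e)^m) y⁆ = ((n : K) + 2 + 2 * m) • ((ad K L e)^m) y := by
    intro m
    induction m with
    | zero => simpa using hhy
    | succ m ih =>
      rw [pow_succ', Module.End.mul_apply, ad_apply, leibniz_lie, ih, t.lie_h_e_smul K, smul_lie,
        lie_smul, ← add_smul]
      congr 1; push_cast; ring
  have hex : ∃ m : ℕ, ((ad K L e)^m) y = 0 := by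
    obtain ⟨m, hm⟩ := hn
    exact ⟨m, by simp [hm]⟩
  classical
  obtain ⟨m, hm⟩ : ∃ m, Nat.find hex = m + 1 := by
    refine Nat.exists_eq_succ_of_ne_zero fun h0 => hy ?_
    have := Nat.find_spec hex
    rw [h0] at this
    simpa using this
  have h1 := Nat.find_spec hex
  have h2 := Nat.find_min hex (m := m) (by omega)
  rw [hm] at h1
  have Py : t.HasPrimitiveVectorWith (((ad K L e)^m) y) ((n : K) + 2 + 2 * m) :=
    ⟨h2, hw m, by rw [pow_succ', Module.End.mul_apply, ad_apply] at h1; exact h1⟩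
  have hN : ((n : K) + 2 + 2 * m) = ((n + 2 + 2 * m : ℕ) : K) := by push_cast; ring
  have h3 := Py.pow_toEnd_f_ne_zero_of_eq_nat hN (i := m) (by omega)
  have h4 := Py.lie_e_pow_succ_toEnd_f m
  obtain ⟨c, hc⟩ := hc m
  change ⁅e, ((ad K L f) ^ (m+1)) (((ad K L e)^m) y)⁆ = _ at h4
  rw [hc, lie_smul, Px.lie_e, smul_zero] at h4
  rcases smul_eq_zero.mp h4.symm with h5 | h5
  · have : ((m:K)+1) * ((n : K) + 2 + 2 * m - m) = (((m+1) * (n+2+m) : ℕ) : K) := by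
      push_cast; ring
    rw [this, Nat.cast_eq_zero] at h5
    simp at h5
  · exact h3 h5

variable [LieAlgebra.IsKilling K L] {H : LieSubalgebra K L} [H.IsCartanSubalgebra]

theorem pd_exists_smul {α : Weight K H L} (hα : α.IsNonZero) {x z : L} (hx : x ∈ rootSpace H α)
    (hx0 : x ≠ 0) (hz : z ∈ rootSpace H α) : ∃ c : K, z = c • x := by
  have h1 := finrank_rootSpace_eq_one α hα
  rw [finrank_eq_one_iff_of_nonzero' (⟨x, hx⟩ : rootSpace H α) (by simpa using hx0)] at h1
  obtain ⟨c, hc⟩ := h1 ⟨z, hz⟩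
  exact ⟨c, by simpa using (congrArg Subtype.val hc).symm⟩

theorem pd_lie_ne {α β γ : Weight K H L} (hα : α.IsNonZero) (hβ : β.IsNonZero)
    (hγ : (γ : H → K) = α + β) {h e f : L} (t : IsSl2Triple h e f)
    (he : e ∈ rootSpace H α) (hf : f ∈ rootSpace H (-α : H → K)) {x : L} (hx : x ∈ rootSpace H β)
    (hx0 : x ≠ 0) : ⁅e, x⁆ ≠ 0 := by
  obtain ⟨y, hy, hy0⟩ := γ.exists_ne_zero
  have hh := t.h_eq_coroot hα he hf
  refine pd_sl2 (K := K) t ?_ hx0 hy0 (l := β (coroot α)) ?_ ?_ ?_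
  · exact isNilpotent_ad_of_mem_rootSpace H hα he
  · rw [hh]
    exact lie_eq_smul_of_mem_rootSpace hx (coroot α)
  · rw [hh]
    have := lie_eq_smul_of_mem_rootSpace hy (coroot α)
    rw [hγ] at this
    simp only [Pi.add_apply, root_apply_coroot hα] at this
    rw [add_comm]; exact this
  · intro m
    have h1 : ((ad K L e)^m) y ∈ rootSpace H (m • (α : H → K) + γ) := by
      induction m with
      | zero => simpa using hy
      | succ m ih =>
        rw [pow_succ', Module.End.mul_apply, ad_apply]
        have := lie_mem_genWeightSpace_of_mem_genWeightSpace he ih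
        convert this using 2
        rw [succ_nsmul']; abel
    have h2 : ∀ i : ℕ, ((ad K L f)^i) (((ad K L e)^m) y) ∈
        rootSpace H (i • (-α : H → K) + (m • (α : H → K) + γ)) := by
      intro i
      induction i with
      | zero => simpa using h1
      | succ i ih =>
        rw [pow_succ', Module.End.mul_apply, ad_apply]
        have := lie_mem_genWeightSpace_of_mem_genWeightSpace hf ih
        convert this using 2
        rw [succ_nsmul']; abel
    have h3 := h2 (m+1)
    have h4 : (m+1) • (-α : H → K) + (m • (α : H → K) + γ) = β := by
      rw [hγ, add_smul, smul_neg, one_smul]; abel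
    rw [h4] at h3
    exact pd_exists_smul hβ hx hx0 h3
end partD

section partD3
variable {K L : Type*} [Field K] [CharZero K] [IsAlgClosed K] [LieRing L] [LieAlgebra K L]
  [FiniteDimensional K L]
variable [LieAlgebra.IsKilling K L] {H : LieSubalgebra K L} [H.IsCartanSubalgebra]

theorem pd_lieSpan_top (b : (rootSystem H).Base) (e f : H.root → L)
    (hsl : ∀ i, IsSl2Triple (coroot i.1 : L) (e i) (f i))
    (he : ∀ i : H.root, e i ∈ rootSpace H i.1) (hf : ∀ i : H.root, f i ∈ rootSpace H (-i.1 : H → K))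
    (A : LieSubalgebra K L) (hA : ∀ i ∈ b.support, e i ∈ A ∧ f i ∈ A) : A = ⊤ := by
  have hnz : ∀ i : H.root, i.1.IsNonZero := fun i => (Finset.mem_filter.mp i.2).2
  have key : ∀ i : H.root, (∀ x ∈ rootSpace H i.1, x ∈ A) ∧
      (∀ x ∈ rootSpace H (-i.1 : H → K), x ∈ A) := by
    intro i
    have hneg : ∀ (i : H.root), ((-i.1 : Weight K H L) : H → K) = -i.1 := fun i => by simp
    have hone : ∀ (i : H.root), (∃ x ∈ rootSpace H i.1, x ∈ A ∧ x ≠ 0) →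
        (∀ x ∈ rootSpace H i.1, x ∈ A) := by
      rintro i ⟨x, hx, hxA, hx0⟩ z hz
      obtain ⟨c, rfl⟩ := pd_exists_smul (hnz i) hx hx0 hz
      exact A.smul_mem c hxA
    have hone' : ∀ (i : H.root), (∃ x ∈ rootSpace H (-i.1 : H → K), x ∈ A ∧ x ≠ 0) →
        (∀ x ∈ rootSpace H (-i.1 : H → K), x ∈ A) := by
      rintro i ⟨x, hx, hxA, hx0⟩ z hz
      rw [← hneg] at hx hz
      obtain ⟨c, rfl⟩ := pd_exists_smul (by simpa using hnz i) hx hx0 hz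
      exact A.smul_mem c hxA
    refine RootPairing.Base.induction_add (P := rootSystem H) (b := b) i
      (p := fun i => (∀ x ∈ rootSpace H i.1, x ∈ A) ∧ (∀ x ∈ rootSpace H (-i.1 : H → K), x ∈ A))
      ?_ ?_ ?_
    · intro i hi
      have : (((rootSystem H).reflectionPerm i i).1 : H → K) = -i.1 := by
        have h1 : (rootSystem H).root ((rootSystem H).reflectionPerm i i) = -(rootSystem H).root i := by
          rw [RootPairing.root_reflectionPerm, RootPairing.reflection_apply_self]
        funext x
        exact congrArg (fun f : Dual K H => f x) h1
      rw [this]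
      refine ⟨hi.2, ?_⟩
      rw [neg_neg]; exact hi.1
    · intro i hi
      exact ⟨hone i ⟨e i, he i, (hA i hi).1, (hsl i).e_ne_zero⟩,
        hone' i ⟨f i, hf i, (hA i hi).2, (hsl i).f_ne_zero⟩⟩
    · intro i j k hk hi hj
      have hk' : (k.1 : H → K) = j.1 + i.1 := by
        funext x
        have h2 := congrArg (fun f : Dual K H => f x) hk
        rw [add_comm]
        simpa using h2
      constructor
      · apply hone
        obtain ⟨x, hx, hx0⟩ := i.1.exists_ne_zero
        refine ⟨⁅e j, x⁆, ?_, A.lie_mem (hA j hj).1 (hi.1 x hx),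
          pd_lie_ne (hnz j) (hnz i) hk' (hsl j) (he j) (hf j) hx hx0⟩
        rw [hk']
        exact lie_mem_genWeightSpace_of_mem_genWeightSpace (he j) hx
      · apply hone'
        obtain ⟨x, hx, hx0⟩ := (-i.1 : Weight K H L).exists_ne_zero
        have hx' := hx
        rw [hneg] at hx'
        refine ⟨⁅f j, x⁆, ?_, A.lie_mem (hA j hj).2 (hi.2 x hx'),
          pd_lie_ne (α := -j.1) (β := -i.1) (γ := -k.1) (by simpa using hnz j)
            (by simpa using hnz i) ?_ (hsl j).symm (by rw [hneg]; exact hf j)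
              (by rw [hneg, neg_neg]; exact he j) hx hx0⟩
        · rw [hk', neg_add]
          exact lie_mem_genWeightSpace_of_mem_genWeightSpace (hf j) hx'
        · rw [hneg, hneg, hneg, hk', neg_add]
  rw [← LieSubalgebra.toSubmodule_inj]
  have hcor : ∀ i : H.root, (coroot i.1 : L) ∈ A := by
    intro i
    rw [← (hsl i).lie_e_f]
    exact A.lie_mem ((key i).1 _ (he i)) ((key i).2 _ (hf i))
  have htop := LieModule.iSup_genWeightSpace_eq_top' K H L
  have htop' : (⨆ χ : Weight K H L, (genWeightSpace L χ : LieSubmodule K H L).toSubmodule) = ⊤ := by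
    rw [← LieSubmodule.iSup_toSubmodule, htop]; rfl
  change _ = (⊤ : Submodule K L)
  rw [eq_top_iff, ← htop', iSup_le_iff]
  intro χ x hx
  by_cases hχ : χ.IsZero
  · have hx' : x ∈ H := by
      have : x ∈ rootSpace H (0 : H → K) := by rw [← hχ.eq]; exact hx
      rw [rootSpace_zero_eq K L H] at this
      simpa using this
    have hspan : Submodule.span K (Set.range (rootSystem H).coroot) = ⊤ := by
      exact RootPairing.IsRootSystem.span_coroot_eq_top
    have : (⟨x, hx'⟩ : H) ∈ Submodule.span K (Set.range (rootSystem H).coroot) := by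
      rw [hspan]; trivial
    have h5 : Submodule.span K (Set.range (rootSystem H).coroot) ≤
        A.toSubmodule.comap H.toSubmodule.subtype := by
      rw [Submodule.span_le]
      rintro _ ⟨i, rfl⟩
      exact hcor i
    exact h5 this
  · exact (key ⟨χ, by simpa using hχ⟩).1 x hx

theorem pd_basis (H : LieSubalgebra K L) [H.IsCartanSubalgebra] :
    ∃ s : Finset H.root, Nonempty (LieAlgebra.Basis s H) := by
  have hnz : ∀ i : H.root, i.1.IsNonZero := fun i => (Finset.mem_filter.mp i.2).2
  obtain ⟨b⟩ := RootPairing.nonempty_base (rootSystem H)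
  have : ∀ i : H.root, ∃ e f : L, IsSl2Triple (coroot i.1 : L) e f ∧ e ∈ rootSpace H i.1 ∧
      f ∈ rootSpace H (-i.1 : H → K) := by
    intro i
    obtain ⟨h, e, f, t, he, hf⟩ := exists_isSl2Triple_of_weight_isNonZero (hnz i)
    exact ⟨e, f, by rw [← t.h_eq_coroot (hnz i) he hf]; exact t, he, hf⟩
  choose e f hsl he hf using this
  have hpair : ∀ i j : b.support, ((b.cartanMatrix i j : ℤ) : K) = i.1.1 (coroot j.1.1) := by
    intro i j
    have := RootPairing.Base.algebraMap_cartanMatrixIn_apply ℤ b i j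
    simpa using this
  refine ⟨b.support, ⟨{
    A := b.cartanMatrix
    h := fun i => (coroot i.1.1 : L)
    e := fun i => e i
    f := fun i => f i
    cartan_eq_lieSpan := ?_
    span_ef := ?_
    linInd := ?_
    nondegen := b.cartanMatrix_nondegenerate
    sl2 := fun i => hsl i
    lie_h_h := ?_
    lie_h_e := ?_
    lie_h_f := ?_
    lie_e_f_ne := ?_ }⟩⟩
  · apply le_antisymm
    · intro x hx
      have hspan : Submodule.span K ((rootSystem H).coroot '' b.support) = ⊤ := by
        rw [b.span_coroot_support]
        exact RootPairing.IsRootSystem.span_coroot_eq_top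
      have : (⟨x, hx⟩ : H) ∈ Submodule.span K ((rootSystem H).coroot '' b.support) := by
        rw [hspan]; trivial
      have h5 : Submodule.span K ((rootSystem H).coroot '' b.support) ≤
          (LieSubalgebra.lieSpan K L (Set.range fun i : b.support => (coroot i.1.1 : L))).toSubmodule.comap H.toSubmodule.subtype := by
        rw [Submodule.span_le]
        rintro _ ⟨i, hi, rfl⟩
        exact LieSubalgebra.subset_lieSpan ⟨⟨i, hi⟩, by simp⟩
      exact h5 this
    · rw [LieSubalgebra.lieSpan_le]
      rintro _ ⟨i, rfl⟩
      exact (coroot i.1.1).2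
  · refine pd_lieSpan_top b e f hsl he hf _ fun i hi => ⟨?_, ?_⟩
    · exact LieSubalgebra.subset_lieSpan (Or.inl ⟨⟨i, hi⟩, rfl⟩)
    · exact LieSubalgebra.subset_lieSpan (Or.inr ⟨⟨i, hi⟩, rfl⟩)
  · have h1 := b.linearIndepOn_coroot
    have h2 := LinearIndependent.map' h1 H.toSubmodule.subtype (Submodule.ker_subtype _)
    exact h2
  · intro i j
    have := LieSubalgebra.coe_bracket H (coroot i.1.1) (coroot j.1.1)
    rw [← this, trivial_lie_zero]; rfl
  · intro i j
    have := lie_eq_smul_of_mem_rootSpace (he i.1) (coroot j.1.1)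
    rw [← hpair, Int.cast_smul_eq_zsmul] at this
    exact this
  · intro i j
    have h0 := hf i.1
    have h1 : ((-i.1.1 : Weight K H L) : H → K) = -i.1.1 := by simp
    rw [← h1] at h0
    have := lie_eq_smul_of_mem_rootSpace h0 (coroot j.1.1)
    rw [h1, Pi.neg_apply, ← hpair, neg_smul, Int.cast_smul_eq_zsmul] at this
    rw [neg_smul]
    exact this
  · intro i j hij
    by_contra hne
    have h1 := lie_mem_genWeightSpace_of_mem_genWeightSpace (he i.1) (hf j.1)
    have h2 : genWeightSpace L (i.1.1 + -j.1.1 : H → K) ≠ ⊥ := by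
      intro h0
      rw [h0] at h1
      exact hne (by simpa using h1)
    let γ : Weight K H L := ⟨_, h2⟩
    have hγ : (γ : H → K) = i.1.1 + -j.1.1 := rfl
    have hγnz : γ.IsNonZero := by
      intro h0
      have h3 : (i.1.1 + -j.1.1 : H → K) = 0 := by rw [← hγ]; exact h0
      have h4 : i.1.1 = j.1.1 := by
        apply LieModule.Weight.ext
        intro x
        have := congrFun h3 x
        simp only [Pi.add_apply, Pi.neg_apply, Pi.zero_apply] at this
        linear_combination this
      exact hij (Subtype.ext (Subtype.ext h4))
    refine b.sub_notMem_range_root i.2 j.2 ⟨⟨γ, by simpa using hγnz⟩, ?_⟩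
    ext x
    simp [hγ, sub_eq_add_neg, Weight.toLinear_apply]
end partD3

section partD4
variable {K L : Type*} [Field K] [CharZero K] [IsAlgClosed K] [LieRing L] [LieAlgebra K L]
  [FiniteDimensional K L]
variable [LieAlgebra.IsKilling K L] {H : LieSubalgebra K L} [H.IsCartanSubalgebra]

theorem pd_ideal (I : LieIdeal K L) (hI : I ≠ ⊥) : ∃ y ∈ I, y ∈ H ∧ y ≠ 0 := by
  by_contra! hcon
  have h0 : LieSubmodule.restr I H ⊓ H.toLieSubmodule = ⊥ := by
    rw [eq_bot_iff]
    rintro x ⟨hx1, hx2⟩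
    exact (LieSubmodule.mem_bot _).mpr (hcon x hx1 (by simpa using hx2))
  have h1 := lieIdeal_eq_inf_cartan_sup_biSup_rootSpace (H := H) I
  rw [h0, bot_sup_eq] at h1
  have h2 : ∀ α : H.root, ¬ rootSpace H (α.1) ≤ LieSubmodule.restr I H := by
    intro α hα
    have hnz := H.isNonZero_coe_root α
    obtain ⟨h, e, f, t, he, hf⟩ := exists_isSl2Triple_of_weight_isNonZero hnz
    refine t.h_ne_zero (hcon h ?_ ?_)
    · rw [← t.lie_e_f, ← lie_skew]
      exact neg_mem (I.lie_mem (hα he))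
    · rw [t.h_eq_coroot hnz he hf]
      exact (coroot α.1).2
  have h3 : LieSubmodule.restr I H = ⊥ := by
    rw [h1]
    simp [h2]
  apply hI
  rw [eq_bot_iff]
  intro x hx
  have : x ∈ LieSubmodule.restr I H := hx
  rw [h3] at this
  exact this

theorem pd_chev (H : LieSubalgebra K L) [H.IsCartanSubalgebra] :
    ∃ θ : L ≃ₗ⁅K⁆ L, ∀ x ∈ H, θ x = -x := by
  obtain ⟨ι, ⟨b⟩⟩ := pd_basis H
  set D : LieSubalgebra K (L × L) := LieSubalgebra.lieSpan K (L × L)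
    (Set.range (fun i => (b.e i, b.f i)) ∪ Set.range (fun i => (b.f i, b.e i))) with hD
  let E : ι → D := fun i => ⟨(b.e i, b.f i), LieSubalgebra.subset_lieSpan (Or.inl ⟨i, rfl⟩)⟩
  let F : ι → D := fun i => ⟨(b.f i, b.e i), LieSubalgebra.subset_lieSpan (Or.inr ⟨i, rfl⟩)⟩
  let h : ι → D := fun i => ⁅E i, F i⁆
  have hh : ∀ i, ((h i : D) : L × L) = (b.h i, - b.h i) := by
    intro i
    simp only [h, E, F, LieSubalgebra.coe_bracket]
    ext
    · exact (b.sl2 i).lie_e_f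
    · exact (b.sl2 i).symm.lie_e_f
  have hspan : LieSubalgebra.lieSpan K D (Set.range E ∪ Set.range F) = ⊤ := by
    have : Set.range E ∪ Set.range F = Subtype.val ⁻¹'
      (Set.range (fun i => (b.e i, b.f i)) ∪ Set.range (fun i => (b.f i, b.e i))) := by
      ext; simp [E, F, Subtype.ext_iff]
    rw [this]
    exact LieSubalgebra.lieSpan_lieSpan_coe_preimage
  let bD : LieAlgebra.Basis ι (LieSubalgebra.lieSpan K D (Set.range h)) :=
  { A := b.A
    h := h
    e := E
    f := F
    cartan_eq_lieSpan := rfl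
    span_ef := hspan
    linInd := by
      refine .of_comp D.subtype (.of_comp (LinearMap.fst K L L) ?_)
      convert b.linInd using 1
      funext i
      exact congrArg Prod.fst (hh i)
    nondegen := b.nondegen
    sl2 := fun i => 
    { h_ne_zero := by 
        have := (b.sl2 i).h_ne_zero
        simp [Subtype.ext_iff, hh, this]
      lie_e_f := rfl
      lie_h_e_nsmul := by
        have h1 := (b.sl2 i).lie_h_e_nsmul
        have h2 := (b.sl2 i).symm.lie_h_e_nsmul
        rw [Subtype.ext_iff]
        simp only [LieSubalgebra.coe_bracket, hh]
        ext
        · exact h1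
        · exact h2
      lie_h_f_nsmul := by
        have h1 := (b.sl2 i).lie_h_f_nsmul
        have h2 := (b.sl2 i).symm.lie_h_f_nsmul
        rw [Subtype.ext_iff]
        simp only [LieSubalgebra.coe_bracket, hh]
        ext
        · exact h1
        · exact h2 }
    lie_h_h := by
      intro i j
      rw [Subtype.ext_iff]
      simp only [LieSubalgebra.coe_bracket, hh]
      ext <;> simp [b.lie_h_h]
    lie_h_e := by
      intro i j
      rw [Subtype.ext_iff]
      simp only [LieSubalgebra.coe_bracket, hh]
      ext <;> simp [E, b.lie_h_e, b.lie_h_f]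
    lie_h_f := by
      intro i j
      rw [Subtype.ext_iff]
      simp only [LieSubalgebra.coe_bracket, hh]
      ext <;> simp [F, b.lie_h_e, b.lie_h_f]
    lie_e_f_ne := by
      intro i j hij
      rw [Subtype.ext_iff]
      simp only [LieSubalgebra.coe_bracket]
      ext
      · simp [E, F, b.lie_e_f_ne i j hij]
      · simp only [E, F]
        have := b.lie_e_f_ne j i hij.symm
        change ⁅b.f i, b.e j⁆ = 0
        rw [← lie_skew, this, neg_zero] }
  have hCart := bD.isCartanSubalgebra
  let p₁ : D →ₗ⁅K⁆ L := (LieHom.fst K L L).comp D.incl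
  let p₂ : D →ₗ⁅K⁆ L := (LieHom.snd K L L).comp D.incl
  have hs₁ : Function.Surjective p₁ := by
    rw [← LieHom.range_eq_top, eq_top_iff, ← b.span_ef, LieSubalgebra.lieSpan_le]
    rintro _ (⟨i, rfl⟩ | ⟨i, rfl⟩)
    · exact ⟨E i, rfl⟩
    · exact ⟨F i, rfl⟩
  have hs₂ : Function.Surjective p₂ := by
    rw [← LieHom.range_eq_top, eq_top_iff, ← b.span_ef, LieSubalgebra.lieSpan_le]
    rintro _ (⟨i, rfl⟩ | ⟨i, rfl⟩)
    · exact ⟨F i, rfl⟩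
    · exact ⟨E i, rfl⟩
  let I : LieIdeal K L := 
    { carrier := {y | ((0, y) : L × L) ∈ D}
      add_mem' := by
        intro a c ha hc
        have := D.add_mem ha hc
        simpa using this
      zero_mem' := D.zero_mem
      smul_mem' := by
        intro c x hx
        have := D.smul_mem c hx
        simpa using this
      lie_mem := by
        intro z y hy
        obtain ⟨w, hw⟩ := hs₂ z
        have := D.lie_mem w.2 hy
        change ((0, ⁅z, y⁆) : L × L) ∈ D
        convert this using 1
        ext
        · simp
        · simp [← hw, p₂] }
  have hI : I = ⊥ := by
    by_contra hne
    obtain ⟨y, hyI, hyH, hy0⟩ := pd_ideal (H := H) I hne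
    have hyD : ((0, y) : L × L) ∈ D := hyI
    have hmem : (⟨_, hyD⟩ : D) ∈ LieSubalgebra.lieSpan K D (Set.range h) := by
      have h1 : (⟨_, hyD⟩ : D) ∈ (LieSubalgebra.lieSpan K D (Set.range h)).normalizer := by
        rw [LieSubalgebra.mem_normalizer_iff]
        intro z hz
        have hz' : z ∈ Submodule.span K (Set.range h) := by
          rw [← LieSubalgebra.mem_toSubmodule] at hz
          rwa [bD.coe_cartan_eq_span] at hz
        have : ⁅(⟨_, hyD⟩ : D), z⁆ = 0 := by
          induction hz' using Submodule.span_induction with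
          | mem z hz'' =>
            obtain ⟨i, rfl⟩ := hz''
            rw [Subtype.ext_iff]
            simp only [LieSubalgebra.coe_bracket, hh]
            ext
            · simp
            · have h3 : b.h i ∈ H := by
                exact b.cartan_eq_lieSpan.ge (LieSubalgebra.subset_lieSpan ⟨i, rfl⟩)
              have := LieSubalgebra.coe_bracket H ⟨y, hyH⟩ ⟨_, h3⟩
              rw [trivial_lie_zero] at this
              change ⁅y, -b.h i⁆ = 0
              rw [lie_neg, neg_eq_zero]
              exact this.symm
          | zero => simp
          | add u v hu hv h1 h2 => 
            rw [← bD.coe_cartan_eq_span] at hu hv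
            rw [lie_add, h1 hu, h2 hv, add_zero]
          | smul c u hu h1 => 
            rw [← bD.coe_cartan_eq_span] at hu
            rw [lie_smul, h1 hu, smul_zero]
        rw [this]; exact zero_mem _
      rwa [hCart.self_normalizing] at h1
    rw [← LieSubalgebra.mem_toSubmodule, bD.coe_cartan_eq_span] at hmem
    obtain ⟨c, hc⟩ := (Submodule.mem_span_range_iff_exists_fun K).mp hmem
    have hc1 := congrArg (fun z : D => (z : L × L)) hc
    have hsum : ((∑ i, c i • bD.h i : D) : L × L) = (∑ i, c i • b.h i, -∑ i, c i • b.h i) := by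
      have h7 : ((∑ i, c i • bD.h i : D) : L × L) = ∑ i, c i • ((h i : D) : L × L) := by
        change D.subtype _ = _
        rw [map_sum]; rfl
      rw [h7, ← Finset.sum_neg_distrib]
      simp only [hh]
      ext
      · simp [Prod.fst_sum]
      · simp [Prod.snd_sum]
    simp only [hsum, Prod.mk.injEq] at hc1
    rw [hc1.1] at hc1
    exact hy0 (by simpa using hc1.2.symm)
  have hi₁ : Function.Injective p₁ := by
    rw [injective_iff_map_eq_zero]
    intro x hx
    have h1 : (x : L × L).2 ∈ I := by
      change ((0, (x : L × L).2) : L × L) ∈ D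
      have : (0, (x : L × L).2) = (x : L × L) := by
        ext
        · exact hx.symm
        · rfl
      rw [this]; exact x.2
    rw [hI] at h1
    ext
    · exact hx
    · exact h1
  let e₁ : D ≃ₗ⁅K⁆ L := LieEquiv.ofBijective p₁ ⟨hi₁, hs₁⟩
  have hi₂ : Function.Injective p₂ := by
    have := LinearMap.injective_iff_surjective_of_finrank_eq_finrank (f := (p₂ : D →ₗ[K] L))
      e₁.toLinearEquiv.finrank_eq
    exact this.mpr hs₂
  let e₂ : D ≃ₗ⁅K⁆ L := LieEquiv.ofBijective p₂ ⟨hi₂, hs₂⟩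
  refine ⟨e₁.symm.trans e₂, ?_⟩
  have key : ∀ i, (e₁.symm.trans e₂) (b.h i) = - b.h i := by
    intro i
    have h1 : e₁ (h i) = b.h i := by
      change ((h i : D) : L × L).1 = _
      rw [hh]
    rw [← h1, LieEquiv.trans_apply, LieEquiv.symm_apply_apply, h1]
    change ((h i : D) : L × L).2 = _
    rw [hh]
  intro x hx
  rw [← LieSubalgebra.mem_toSubmodule, b.coe_cartan_eq_span] at hx
  induction hx using Submodule.span_induction with
  | mem z hz => obtain ⟨i, rfl⟩ := hz; exact key i
  | zero => simp
  | add u v _ _ h1 h2 => rw [map_add, h1, h2, neg_add]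
  | smul c u _ h1 => rw [map_smul, h1, smul_neg]
end partD4

section partE
variable {K L : Type*} [Field K] [CharZero K] [IsAlgClosed K] [LieRing L] [LieAlgebra K L]
  [FiniteDimensional K L]
variable [LieAlgebra.IsKilling K L] {H : LieSubalgebra K L} [H.IsCartanSubalgebra]

theorem pe_top_le (S : Submodule K L) (h0 : ∀ x ∈ H, x ∈ S)
    (h1 : ∀ α : Weight K H L, α.IsNonZero → ∀ x ∈ rootSpace H α, x ∈ S) : ∀ x, x ∈ S := by
  have htop := LieModule.iSup_genWeightSpace_eq_top' K H L
  have htop' : (⨆ χ : Weight K H L, (genWeightSpace L χ : LieSubmodule K H L).toSubmodule) = ⊤ := by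
    rw [← LieSubmodule.iSup_toSubmodule, htop]; rfl
  suffices (⊤ : Submodule K L) ≤ S from fun x => this trivial
  rw [← htop', iSup_le_iff]
  intro χ x hx
  by_cases hχ : χ.IsZero
  · apply h0
    have : x ∈ rootSpace H (0 : H → K) := by rw [← hχ.eq]; exact hx
    rw [rootSpace_zero_eq K L H] at this
    simpa using this
  · exact h1 χ hχ x hx

theorem pe_mem (χ : H → K) (x : L) (h : ∀ y : H, ⁅(y : L), x⁆ = χ y • x) : x ∈ rootSpace H χ := by
  apply weightSpace_le_genWeightSpace L χ
  rw [mem_weightSpace]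
  exact h

theorem pe (H : LieSubalgebra K L) [H.IsCartanSubalgebra] (mu : L ≃ₗ⁅K⁆ L)
    (h2 : ∀ x, mu (mu x) = x) (hH : ∀ x ∈ H, mu x = x) :
    ∃ θ θ' : L ≃ₗ⁅K⁆ L, (∀ x, θ (θ x) = x) ∧ (∀ x, θ' (θ' x) = x) ∧
      (∀ x ∈ H, θ x = -x) ∧ (∀ x ∈ H, θ' x = -x) ∧ (∀ x, θ (θ' x) = θ' (θ x)) ∧
      ∀ x, mu x = θ (θ' x) := by
  obtain ⟨θ, hθ⟩ := pd_chev H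
  have key : ∀ α : Weight K H L, α.IsNonZero → ∀ x ∈ rootSpace H α, θ (θ x) = x ∧
      θ (mu x) = mu (θ x) := by
    intro α hα x hx
    obtain ⟨h, e, f, t, he, hf⟩ := exists_isSl2Triple_of_weight_isNonZero hα
    have hneg : ((-α : Weight K H L) : H → K) = -α := by simp
    have hf' := hf
    rw [← hneg] at hf'
    have hα' : (-α).IsNonZero := by simpa using hα
    have hh : h ∈ H := by
      rw [t.h_eq_coroot hα he hf]; exact (coroot α).2
    have hθm : ∀ β : Weight K H L, ∀ z ∈ rootSpace H β, θ z ∈ rootSpace H (-β : Weight K H L) := by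
      intro β z hz
      apply pe_mem
      intro y
      have h1 := congrArg θ (lie_eq_smul_of_mem_rootSpace hz y)
      rw [LieSubalgebra.coe_bracket_of_module, LieEquiv.map_lie, hθ y y.2, neg_lie, map_smul] at h1
      have hneg : ((-β : Weight K H L) : H → K) = -β := by simp
      rw [hneg, Pi.neg_apply, neg_smul, ← h1, neg_neg]
    have hmm : ∀ β : Weight K H L, ∀ z ∈ rootSpace H β, mu z ∈ rootSpace H β := by
      intro β z hz
      apply pe_mem
      intro y
      have h1 := congrArg mu (lie_eq_smul_of_mem_rootSpace hz y)
      rwa [LieSubalgebra.coe_bracket_of_module, LieEquiv.map_lie, hH y y.2, map_smul] at h1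
    obtain ⟨r, rfl⟩ := pd_exists_smul hα he t.e_ne_zero hx
    obtain ⟨a, ha⟩ := pd_exists_smul hα' hf' t.f_ne_zero (hθm α e he)
    obtain ⟨b, hb⟩ := pd_exists_smul hα he t.e_ne_zero (z := θ f)
      (by have := hθm (-α) f hf'; rwa [neg_neg] at this)
    obtain ⟨c, hc⟩ := pd_exists_smul hα he t.e_ne_zero (hmm α e he)
    obtain ⟨d, hd⟩ := pd_exists_smul hα' hf' t.f_ne_zero (hmm (-α) f hf')
    have hab : a * b = 1 := by
      have h1 := congrArg θ t.lie_e_f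
      rw [LieEquiv.map_lie, ha, hb, hθ h hh, smul_lie, lie_smul, ← lie_skew, t.lie_e_f, smul_neg,
        smul_neg, neg_inj, smul_smul] at h1
      have h3 : (a * b - 1) • h = 0 := by rw [sub_smul, h1, one_smul, sub_self]
      have := (smul_eq_zero.mp h3).resolve_right t.h_ne_zero
      linear_combination this
    have hcd : c * d = 1 := by
      have h1 := congrArg mu t.lie_e_f
      rw [LieEquiv.map_lie, hc, hd, hH h hh, smul_lie, lie_smul, t.lie_e_f, smul_smul] at h1
      have h3 : (c * d - 1) • h = 0 := by rw [sub_smul, h1, one_smul, sub_self]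
      have := (smul_eq_zero.mp h3).resolve_right t.h_ne_zero
      linear_combination this
    have hcc : c * c = 1 := by
      have h1 := h2 e
      rw [hc, map_smul, hc, smul_smul] at h1
      have h3 : (c * c - 1) • e = 0 := by rw [sub_smul, h1, one_smul, sub_self]
      have := (smul_eq_zero.mp h3).resolve_right t.e_ne_zero
      linear_combination this
    have hcd' : c = d := by linear_combination d * hcc - c * hcd
    constructor
    · rw [map_smul, ha, map_smul, map_smul, hb, smul_smul a, hab, one_smul]
    · simp only [map_smul, hc, ha, hd, hcd', smul_comm d]
  have hθθ : ∀ x, θ (θ x) = x := by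
    intro x
    let S := LinearMap.eqLocus ((θ.toLinearEquiv : L →ₗ[K] L) ∘ₗ (θ.toLinearEquiv : L →ₗ[K] L))
      LinearMap.id
    refine pe_top_le (H := H) S ?_ ?_ x
    · intro x hx
      change θ (θ x) = x
      rw [hθ x hx, map_neg, hθ x hx, neg_neg]
    · exact fun α hα x hx => (key α hα x hx).1
  have hcomm : ∀ x, θ (mu x) = mu (θ x) := by
    intro x
    let S := LinearMap.eqLocus ((θ.toLinearEquiv : L →ₗ[K] L) ∘ₗ (mu.toLinearEquiv : L →ₗ[K] L))
      ((mu.toLinearEquiv : L →ₗ[K] L) ∘ₗ (θ.toLinearEquiv : L →ₗ[K] L))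
    refine pe_top_le (H := H) S ?_ ?_ x
    · intro x hx
      change θ (mu x) = mu (θ x)
      rw [hH x hx, hθ x hx, map_neg, hH x hx]
    · exact fun α hα x hx => (key α hα x hx).2
  refine ⟨θ, mu.trans θ, hθθ, ?_, hθ, ?_, ?_, ?_⟩
  · intro x
    simp only [LieEquiv.trans_apply]
    rw [hcomm, hθθ, h2]
  · intro x hx
    rw [LieEquiv.trans_apply, hH x hx, hθ x hx]
  · intro x
    simp only [LieEquiv.trans_apply]
    rw [hcomm]
  · intro x
    rw [LieEquiv.trans_apply, hθθ]
end partE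

section partA1
open MvPolynomial
variable {K ι : Type*} [Field K] [CharZero K] [Fintype ι] [DecidableEq ι]

noncomputable def paL (A : Matrix ι ι K) :
    Derivation K (MvPolynomial (ι × ι) K) (MvPolynomial (ι × ι) K) :=
  MvPolynomial.mkDerivation K (fun p => ∑ l, C (A p.1 l) * X (l, p.2))

noncomputable def paE {R : Type*} [CommRing R] [Algebra K R] (M : Matrix ι ι R) :
    MvPolynomial (ι × ι) K →ₐ[K] R := MvPolynomial.aeval (fun p => M p.1 p.2)

theorem paL_add (A B : Matrix ι ι K) : paL (A + B) = paL A + paL B := by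
  apply MvPolynomial.derivation_ext
  intro p
  simp [paL, MvPolynomial.mkDerivation_X, add_mul, Finset.sum_add_distrib]

theorem paL_smul (c : K) (A : Matrix ι ι K) : paL (c • A) = c • paL A := by
  apply MvPolynomial.derivation_ext
  intro p
  simp [paL, MvPolynomial.mkDerivation_X, Finset.smul_sum, MvPolynomial.smul_eq_C_mul, mul_assoc]

theorem pa1 {R : Type*} [CommRing R] [Algebra K R] (D : Derivation K R R) (M : Matrix ι ι R)
    (A : Matrix ι ι K) (hM : ∀ i j, D (M i j) = ∑ l, algebraMap K R (A i l) * M l j)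
    (F : MvPolynomial (ι × ι) K) : D (paE M F) = paE M (paL A F) := by
  induction F using MvPolynomial.induction_on with
  | C a => simp [paE]
  | add p q hp hq => simp [hp, hq]
  | mul_X p n hp =>
    rw [map_mul, Derivation.leibniz, Derivation.leibniz, hp]
    simp only [map_add, smul_eq_mul, map_mul]
    congr 2
    simp only [paE, aeval_X, hM, paL, MvPolynomial.mkDerivation_X, map_sum, map_mul]
    simp [MvPolynomial.aeval_C]

theorem paE_map {R R' : Type*} [CommRing R] [Algebra K R] [CommRing R'] [Algebra K R']
    (φ : R →ₐ[K] R') (M : Matrix ι ι R) (F : MvPolynomial (ι × ι) K) :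
    φ (paE M F) = paE (M.map φ) F := by
  have : φ.comp (paE M) = paE (M.map φ) := by
    apply MvPolynomial.algHom_ext
    intro p
    simp [paE]
  exact DFunLike.congr_fun this F

/-- the polynomial curve `exp (tA) σ` -/
noncomputable def paC (N : ℕ) (A B : Matrix ι ι K) : Matrix ι ι (Polynomial K) :=
  fun i j => ∑ m ∈ Finset.range N, Polynomial.monomial m ((m.factorial : K)⁻¹ * (A ^ m * B) i j)

theorem paC_eval (N : ℕ) (A B : Matrix ι ι K) (t : K) :
    (paC N A B).map (Polynomial.aeval t : Polynomial K →ₐ[K] K) =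
      (∑ m ∈ Finset.range N, (m.factorial : K)⁻¹ • (t • A) ^ m) * B := by
  ext i j
  simp only [Matrix.map_apply, paC, map_sum, Polynomial.aeval_monomial]
  rw [Matrix.sum_mul, Matrix.sum_apply]
  refine Finset.sum_congr rfl fun m _ => ?_
  rw [smul_pow, smul_mul_assoc, smul_mul_assoc]
  simp
  ring

theorem paC_D (N : ℕ) (A B : Matrix ι ι K) (hA : A ^ N = 0) (i j : ι) :
    Polynomial.derivative' (paC N A B i j) = ∑ l, algebraMap K (Polynomial K) (A i l) * paC N A B l j := by
  have hR : ∑ l, algebraMap K (Polynomial K) (A i l) * paC N A B l j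
      = ∑ m ∈ Finset.range N, Polynomial.monomial m ((m.factorial : K)⁻¹ * (A ^ (m+1) * B) i j) := by
    simp only [paC, Finset.mul_sum]
    rw [Finset.sum_comm]
    refine Finset.sum_congr rfl fun m _ => ?_
    rw [pow_succ', Matrix.mul_assoc, Matrix.mul_apply (M := A), Finset.mul_sum, map_sum]
    refine Finset.sum_congr rfl fun l _ => ?_
    rw [Polynomial.algebraMap_eq, Polynomial.C_mul_monomial]
    congr 1; ring
  rw [hR]
  cases N with
  | zero => simp [paC]
  | succ N =>
    rw [Finset.sum_range_succ, hA]
    simp only [paC, Polynomial.derivative'_apply, Polynomial.derivative_sum, Polynomial.derivative_monomial]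
    rw [Finset.sum_range_succ']
    simp only [Matrix.zero_mul, Matrix.zero_apply, mul_zero, map_zero, add_zero, Nat.cast_zero]
    refine Finset.sum_congr rfl fun m _ => ?_
    rw [Nat.add_sub_cancel]
    congr 1
    rw [Nat.factorial_succ]
    have h1 : ((m.factorial : ℕ) : K) ≠ 0 := by exact_mod_cast m.factorial_ne_zero
    have h2 : ((m + 1 : ℕ) : K) ≠ 0 := by exact_mod_cast m.succ_ne_zero
    push_cast at h2 ⊢
    field_simp

theorem pa2_deriv (N : ℕ) (A B : Matrix ι ι K) (hA : A ^ N = 0) (F : MvPolynomial (ι × ι) K) :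
    Polynomial.derivative (paE (paC N A B) F) = paE (paC N A B) (paL A F) :=
  pa1 Polynomial.derivative' _ A (paC_D N A B hA) F

theorem pa2_eval (N : ℕ) (A B : Matrix ι ι K) (t : K) (F : MvPolynomial (ι × ι) K) :
    Polynomial.eval t (paE (paC N A B) F) =
      paE ((∑ m ∈ Finset.range N, (m.factorial : K)⁻¹ • (t • A) ^ m) * B) F := by
  rw [← paC_eval, ← paE_map, Polynomial.coe_aeval_eq_eval]

theorem pa_sum_zero (N : ℕ) (hN : 0 < N) (A : Matrix ι ι K) :
    (∑ m ∈ Finset.range N, (m.factorial : K)⁻¹ • ((0 : K) • A) ^ m) = 1 := by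
  obtain ⟨N, rfl⟩ := Nat.exists_eq_succ_of_ne_zero hN.ne'
  rw [Finset.sum_range_succ']
  simp

theorem pa2 (N : ℕ) (hN : 0 < N) (A B : Matrix ι ι K) (hA : A ^ N = 0) (F : MvPolynomial (ι × ι) K)
    (h : ∀ t : K, paE ((∑ m ∈ Finset.range N, (m.factorial : K)⁻¹ • (t • A) ^ m) * B) F = 0) :
    paE B (paL A F) = 0 := by
  have h0 : paE (paC N A B) F = 0 := by
    apply Polynomial.funext
    intro t
    rw [pa2_eval, h, Polynomial.eval_zero]
  have h1 := pa2_deriv N A B hA F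
  rw [h0, Polynomial.derivative_zero] at h1
  have h2 := pa2_eval N A B 0 (paL A F)
  rw [← h1, Polynomial.eval_zero, pa_sum_zero N hN, Matrix.one_mul] at h2
  exact h2.symm

theorem pa4 (N : ℕ) (hN : 0 < N) (A B : Matrix ι ι K) (hA : A ^ N = 0)
    (J : Set (MvPolynomial (ι × ι) K)) (hJ : ∀ F ∈ J, paL A F ∈ J) (hB : ∀ F ∈ J, paE B F = 0)
    (F : MvPolynomial (ι × ι) K) (hF : F ∈ J) :
    paE ((∑ m ∈ Finset.range N, (m.factorial : K)⁻¹ • A ^ m) * B) F = 0 := by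
  have h1 : ∀ m : ℕ, ∀ F ∈ J, Polynomial.eval 0 (Polynomial.derivative^[m] (paE (paC N A B) F)) = 0 := by
    intro m
    induction m with
    | zero =>
      intro F hF
      rw [Function.iterate_zero, id, pa2_eval, pa_sum_zero N hN, Matrix.one_mul, hB F hF]
    | succ m ih =>
      intro F hF
      rw [Function.iterate_succ_apply, pa2_deriv N A B hA]
      exact ih _ (hJ F hF)
  have h2 : paE (paC N A B) F = 0 := by
    ext m
    have := h1 m F hF
    rw [← Polynomial.coeff_zero_eq_eval_zero, Polynomial.coeff_iterate_derivative] at this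
    simp only [zero_add, Nat.descFactorial_self] at this
    rw [nsmul_eq_mul, mul_eq_zero] at this
    rw [Polynomial.coeff_zero]
    exact this.resolve_left (by exact_mod_cast m.factorial_ne_zero)
  have h3 := pa2_eval N A B 1 F
  rw [h2, Polynomial.eval_zero] at h3
  simp only [one_smul] at h3
  exact h3.symm
end partA1

section partA2
open LaurentPolynomial
variable {K ι : Type*} [Field K] [CharZero K] [Fintype ι] [DecidableEq ι]

noncomputable def plE (x : Kˣ) : LaurentPolynomial K →ₐ[K] K :=
  { LaurentPolynomial.eval₂ (RingHom.id K) x with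
    commutes' := fun r => by
      have := LaurentPolynomial.eval₂_C (RingHom.id K) x r
      simpa using this }

theorem plE_apply (x : Kˣ) (p : LaurentPolynomial K) :
    plE x p = LaurentPolynomial.eval₂ (RingHom.id K) x p := rfl

noncomputable def plD0 : LaurentPolynomial K →ₗ[K] LaurentPolynomial K :=
  (Finsupp.linearCombination K (fun n : ℤ => ((n : K) • (T n : LaurentPolynomial K)))).comp
    (AddMonoidAlgebra.coeffLinearEquiv K).toLinearMap

theorem plD0_T (n : ℤ) : plD0 (T n : LaurentPolynomial K) = (n : K) • T n := by
  have h : AddMonoidAlgebra.coeffLinearEquiv K (T n : LaurentPolynomial K) = Finsupp.single n 1 := by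
    ext m
    have := T_apply (R := K) m n
    rw [Finsupp.single_apply]
    exact this
  rw [plD0, LinearMap.comp_apply, LinearEquiv.coe_coe, h, Finsupp.linearCombination_single, one_smul]

noncomputable def plD : Derivation K (LaurentPolynomial K) (LaurentPolynomial K) :=
  Derivation.mk' plD0 (by
    intro a b
    induction a using LaurentPolynomial.induction_on' with
    | add p q hp hq =>
      rw [add_mul, map_add, map_add, hp, hq]; simp only [smul_eq_mul]; ring
    | C_mul_T n c =>
      induction b using LaurentPolynomial.induction_on' with
      | add p q hp hq =>
        rw [mul_add, map_add, map_add, hp, hq]; simp only [smul_eq_mul]; ring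
      | C_mul_T m d =>
        have e : (C c * T n) * (C d * T m) = (c * d) • (T (n + m) : LaurentPolynomial K) := by
          rw [T_add, LaurentPolynomial.smul_eq_C_mul, map_mul]; ring
        rw [e, ← LaurentPolynomial.smul_eq_C_mul, ← LaurentPolynomial.smul_eq_C_mul, map_smul, map_smul, map_smul,
          plD0_T, plD0_T, plD0_T]
        simp only [LaurentPolynomial.smul_eq_C_mul, T_add, smul_eq_mul, map_mul, Int.cast_add, map_add]
        ring)

theorem plD_T (n : ℤ) : plD (T n : LaurentPolynomial K) = (n : K) • T n := plD0_T n

open Classical in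
theorem pl_zero (p : LaurentPolynomial K) (B : Finset K) (h : ∀ x : Kˣ, (x : K) ∉ B → plE x p = 0) :
    p = 0 := by
  obtain ⟨n, f, hf⟩ := exists_T_pow p
  have h0 : f = 0 := by
    refine Polynomial.eq_zero_of_infinite_isRoot f (Set.Infinite.mono ?_ ((insert (0:K) B).finite_toSet.infinite_compl))
    intro c hc
    have hc' : c ∉ insert 0 B := hc
    rw [Finset.mem_insert, not_or] at hc'
    have h1 := h (Units.mk0 c hc'.1) hc'.2
    have h2 := LaurentPolynomial.eval₂_toLaurent (RingHom.id K) (Units.mk0 c hc'.1) f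
    rw [hf, map_mul, ← plE_apply, h1, zero_mul] at h2
    exact h2.symm
  rw [h0, map_zero] at hf
  exact ((isUnit_T (n : ℤ)).mul_left_eq_zero).1 hf.symm

theorem pa3 {κ : Type*} (s : Finset κ) (n : κ → ℤ) (P : κ → Matrix ι ι K) (A : Matrix ι ι K)
    (hA : ∀ i ∈ s, A * P i = (n i : K) • P i) (F : MvPolynomial (ι × ι) K) (B : Finset K)
    (h : ∀ c : K, c ≠ 0 → c ∉ B → paE (∑ i ∈ s, c ^ (n i) • P i) F = 0) :
    paE (∑ i ∈ s, P i) (paL A F) = 0 := by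
  set M : Matrix ι ι (LaurentPolynomial K) := fun a b => ∑ i ∈ s, (P i a b) • T (n i) with hM
  have hev : ∀ x : Kˣ, M.map (plE x) = ∑ i ∈ s, (x : K) ^ (n i) • P i := by
    intro x
    ext a b
    rw [Matrix.map_apply, hM, Matrix.sum_apply]
    simp only [map_sum, map_smul, plE_apply, eval₂_T, Matrix.smul_apply, smul_eq_mul, Units.val_zpow_eq_zpow_val]
    exact Finset.sum_congr rfl fun i _ => mul_comm _ _
  have h0 : paE M F = 0 := by
    refine pl_zero _ B fun x hx => ?_
    rw [paE_map, hev]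
    exact h x x.ne_zero hx
  have h1 := pa1 plD M A (by
    intro a b
    change plD (∑ i ∈ s, (P i a b) • T (n i)) = ∑ l, algebraMap K _ (A a l) * (∑ i ∈ s, (P i l b) • T (n i))
    simp only [Finset.mul_sum]
    rw [Finset.sum_comm, map_sum]
    refine Finset.sum_congr rfl fun i hi => ?_
    rw [Derivation.map_smul, plD_T]
    have := congrFun (congrFun (hA i hi) a) b
    rw [Matrix.mul_apply, Matrix.smul_apply, smul_eq_mul] at this
    rw [smul_smul, mul_comm, ← this, Finset.sum_smul]
    refine Finset.sum_congr rfl fun l _ => ?_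
    rw [← Algebra.smul_def, smul_smul]) F
  rw [h0, map_zero] at h1
  have h2 := paE_map (plE (1 : Kˣ)) M (paL A F)
  rw [← h1, map_zero, hev] at h2
  simpa using h2.symm
end partA2

section partA3
open Polynomial
variable {K L : Type*} [Field K] [IsAlgClosed K] [AddCommGroup L] [Module K L]
  [FiniteDimensional K L]

noncomputable def pS (f : Module.End K L) : Finset K := by
  classical exact f.charpoly.roots.toFinset

open Classical in
noncomputable def pP (f : Module.End K L) (a : K) : Module.End K L :=
  aeval f (Lagrange.basis (pS f) id a)

noncomputable def pT (f : Module.End K L) (w : K → K) : Module.End K L :=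
  ∑ a ∈ pS f, w a • pP f a

theorem pS_mem (f : Module.End K L) (a : K) (v : L) (hv : f v = a • v) (h0 : v ≠ 0) : a ∈ pS f := by
  classical
  have h1 : f.HasEigenvalue a := by
    refine Module.End.hasEigenvalue_of_hasEigenvector (x := v) ⟨?_, h0⟩
    rw [Module.End.mem_eigenspace_iff, hv]
  rw [Module.End.hasEigenvalue_iff_isRoot_charpoly] at h1
  rw [pS, Multiset.mem_toFinset, Polynomial.mem_roots f.charpoly_monic.ne_zero]
  exact h1

open Classical in
theorem pP_apply (f : Module.End K L) (a b : K) (v : L) (hv : f v = b • v) (ha : a ∈ pS f) :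
    pP f a v = if a = b then v else 0 := by
  classical
  by_cases h0 : v = 0
  · simp [h0]
  have hb := pS_mem f b v hv h0
  have h1 : pP f a v = (Lagrange.basis (pS f) id a).eval b • v :=
    Module.End.aeval_apply_of_hasEigenvector ⟨(Module.End.mem_eigenspace_iff).2 hv, h0⟩
  rw [h1]
  split_ifs with h
  · subst h
    have := Lagrange.eval_basis_self (s := pS f) (v := id) (i := a) (Function.injective_id.injOn) ha
    rw [id] at this
    rw [this, one_smul]
  · have := Lagrange.eval_basis_of_ne (s := pS f) (v := id) h hb
    rw [id] at this
    rw [this, zero_smul]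

theorem pT_apply (f : Module.End K L) (w : K → K) (b : K) (v : L) (hv : f v = b • v) :
    pT f w v = w b • v := by
  classical
  by_cases h0 : v = 0
  · simp [h0]
  have hb := pS_mem f b v hv h0
  rw [pT, LinearMap.sum_apply, Finset.sum_eq_single b]
  · rw [LinearMap.smul_apply, pP_apply f b b v hv hb, if_pos rfl]
  · intro c hc hcb
    rw [LinearMap.smul_apply, pP_apply f c b v hv hc, if_neg hcb, smul_zero]
  · exact fun h => absurd hb h

theorem pss_top (f : Module.End K L) (hf : f.IsSemisimple) : ⨆ a, f.eigenspace a = ⊤ := by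
  rw [← Module.End.iSup_maxGenEigenspace_eq_top f]
  congr 1
  ext1 a
  rw [hf.isFinitelySemisimple.maxGenEigenspace_eq_eigenspace]

theorem pss_ind (f : Module.End K L) (hf : f.IsSemisimple) (S : Submodule K L)
    (h : ∀ (a : K) (v : L), f v = a • v → v ∈ S) (x : L) : x ∈ S := by
  suffices (⊤ : Submodule K L) ≤ S from this trivial
  rw [← pss_top f hf, iSup_le_iff]
  intro a v hv
  exact h a v ((Module.End.mem_eigenspace_iff).1 hv)

theorem pss_ext (f : Module.End K L) (hf : f.IsSemisimple) (A B : Module.End K L)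
    (h : ∀ (a : K) (v : L), f v = a • v → A v = B v) : A = B := by
  ext x
  exact pss_ind f hf (LinearMap.eqLocus A B) h x

theorem pP_sum (f : Module.End K L) (hf : f.IsSemisimple) : ∑ a ∈ pS f, pP f a = 1 := by
  refine pss_ext f hf _ _ fun a v hv => ?_
  have := pT_apply f 1 a v hv
  simpa [pT] using this

theorem pP_mul (f : Module.End K L) (hf : f.IsSemisimple) (a : K) (ha : a ∈ pS f) :
    f * pP f a = a • pP f a := by
  refine pss_ext f hf _ _ fun b v hv => ?_
  rw [Module.End.mul_apply, LinearMap.smul_apply, pP_apply f a b v hv ha]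
  split_ifs with h
  · rw [h, hv]
  · simp

theorem pfix (ψ : Module.End K L) (A : Submodule K L) {I : Type*} (B : I → Submodule K L)
    (hsup : A ⊔ ⨆ i, B i = ⊤) (c : I → K) (hc : ∀ i, c i ≠ 0)
    (hB : ∀ i, ∀ x ∈ B i, ψ x = c i • x) (hA : ∀ x ∈ A, ψ x = 0) (x : L) (hx : ψ x = 0) : x ∈ A := by
  have h1 : ∀ i, B i ≤ (⨆ i, B i).comap ψ := by
    intro i v hv
    rw [Submodule.mem_comap, hB i v hv]
    exact Submodule.smul_mem _ _ (Submodule.mem_iSup_of_mem i hv)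
  have h2 : ∀ i, B i ≤ (⨆ i, B i).map ψ := by
    intro i v hv
    refine ⟨(c i)⁻¹ • v, Submodule.smul_mem _ _ (Submodule.mem_iSup_of_mem i hv), ?_⟩
    rw [map_smul, hB i v hv, inv_smul_smul₀ (hc i)]
  have h1' := iSup_le h1
  have h2' := iSup_le h2
  let φ := ψ.restrict (p := ⨆ i, B i) (q := ⨆ i, B i) (fun v hv => h1' hv)
  have hs : Function.Surjective φ := by
    rintro ⟨v, hv⟩
    obtain ⟨u, hu, huv⟩ := h2' hv
    exact ⟨⟨u, hu⟩, Subtype.ext huv⟩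
  have hi := LinearMap.injective_iff_surjective.2 hs
  have hxt : x ∈ A ⊔ ⨆ i, B i := by rw [hsup]; trivial
  obtain ⟨a, ha, b, hb, rfl⟩ := Submodule.mem_sup.1 hxt
  rw [map_add, hA a ha, zero_add] at hx
  have : (⟨b, hb⟩ : (⨆ i, B i : Submodule K L)) = 0 := hi (Subtype.ext (by simpa [φ] using hx))
  have hb0 : b = 0 := congrArg Subtype.val this
  rw [hb0, add_zero]
  exact ha
end partA3

section partA3b
variable {K L : Type*} [Field K] [IsAlgClosed K] [LieRing L] [LieAlgebra K L]
  [FiniteDimensional K L]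

theorem pt (y : L) (hy : (ad K L y).IsSemisimple) (w : K → K) (hw : ∀ a, w a ≠ 0)
    (hm : ∀ a b, a ∈ pS (ad K L y) → b ∈ pS (ad K L y) → a + b ∈ pS (ad K L y) → w (a + b) = w a * w b) :
    ∃ T : L ≃ₗ⁅K⁆ L, ∀ x, T x = pT (ad K L y) w x := by
  set f := ad K L y with hf
  have hb : ∀ u v, pT f w ⁅u, v⁆ = ⁅pT f w u, pT f w v⁆ := by
    intro u v
    let S1 : Submodule K L :=
      { carrier := {u | pT f w ⁅u, v⁆ = ⁅pT f w u, pT f w v⁆}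
        add_mem' := fun {a b} ha hb => by
          simp only [Set.mem_setOf_eq] at ha hb ⊢
          rw [add_lie, map_add, map_add, add_lie, ha, hb]
        zero_mem' := by simp
        smul_mem' := fun c a ha => by
          simp only [Set.mem_setOf_eq] at ha ⊢
          rw [smul_lie, map_smul, map_smul, smul_lie, ha] }
    refine pss_ind f hy S1 ?_ u
    intro a u hu
    change pT f w ⁅u, v⁆ = ⁅pT f w u, pT f w v⁆
    let S2 : Submodule K L :=
      { carrier := {v | pT f w ⁅u, v⁆ = ⁅pT f w u, pT f w v⁆}
        add_mem' := fun {a b} ha hb => by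
          simp only [Set.mem_setOf_eq] at ha hb ⊢
          rw [lie_add, map_add, map_add, lie_add, ha, hb]
        zero_mem' := by simp
        smul_mem' := fun c a ha => by
          simp only [Set.mem_setOf_eq] at ha ⊢
          rw [lie_smul, map_smul, map_smul, lie_smul, ha] }
    refine pss_ind f hy S2 ?_ v
    intro b v hv
    change pT f w ⁅u, v⁆ = ⁅pT f w u, pT f w v⁆
    rw [pT_apply f w a u hu, pT_apply f w b v hv]
    by_cases h0 : ⁅u, v⁆ = 0
    · simp [h0]
    have huv : f ⁅u, v⁆ = (a + b) • ⁅u, v⁆ := by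
      have hu' : ⁅y, u⁆ = a • u := hu
      have hv' : ⁅y, v⁆ = b • v := hv
      rw [hf, ad_apply, leibniz_lie, hu', hv', smul_lie, lie_smul, add_smul]
    rw [pT_apply f w _ _ huv, hm a b (pS_mem f a u hu ?_) (pS_mem f b v hv ?_) (pS_mem f _ _ huv h0),
      smul_lie, lie_smul, smul_smul]
    · rintro rfl; simp at h0
    · rintro rfl; simp at h0
  have hinj : pT f (fun a => (w a)⁻¹) * pT f w = 1 := by
    refine pss_ext f hy _ _ fun a v hv => ?_
    rw [Module.End.mul_apply, pT_apply f w a v hv, map_smul, pT_apply f _ a v hv, smul_inv_smul₀ (hw a)]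
    rfl
  have hi : Function.Injective (pT f w) := by
    intro a b hab
    have := congrArg (pT f (fun a => (w a)⁻¹)) hab
    rw [← Module.End.mul_apply, ← Module.End.mul_apply, hinj] at this
    exact this
  let T0 : L →ₗ⁅K⁆ L := { pT f w with map_lie' := fun {u v} => hb u v }
  exact ⟨LieEquiv.ofBijective T0 ⟨hi, LinearMap.injective_iff_surjective.1 hi⟩, fun x => rfl⟩
end partA3b

section partA4
variable {K L : Type*} [Field K] [CharZero K] [LieRing L] [LieAlgebra K L]
  [FiniteDimensional K L]

variable (K L) in
noncomputable def pX (f : Module.End K L) : Module.End K L :=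
  ∑ i ∈ Finset.range (finrank K L + 1), (i.factorial : K)⁻¹ • f ^ i

theorem pnil_pow (f : Module.End K L) (hf : IsNilpotent f) : f ^ (finrank K L + 1) = 0 := by
  have h1 : f.charpoly = Polynomial.X ^ finrank K L := ((LinearMap.charpoly_nilpotent_tfae f).out 0 1).1 hf
  have h2 := LinearMap.aeval_self_charpoly f
  rw [h1, map_pow, Polynomial.aeval_X] at h2
  rw [pow_succ, h2, zero_mul]

theorem pX_exp [Module ℚ L] (f : Module.End K L) (hf : IsNilpotent f) : IsNilpotent.exp f = pX K L f := by
  rw [IsNilpotent.exp_eq_sum (pnil_pow f hf), pX]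
  refine Finset.sum_congr rfl fun i _ => ?_
  ext v
  rw [LinearMap.smul_apply, LinearMap.smul_apply, ← Rat.cast_smul_eq_qsmul K]
  simp

theorem pX_add (f g : Module.End K L) (hf : IsNilpotent f) (hg : IsNilpotent g) (h : Commute f g) :
    pX K L (f + g) = pX K L f * pX K L g := by
  letI : Module ℚ L := Module.compHom L (algebraMap ℚ K)
  rw [← pX_exp _ hf, ← pX_exp _ hg, ← pX_exp _ (h.isNilpotent_add hf hg),
    IsNilpotent.exp_add_of_commute h hf hg]

theorem pX_zero : pX K L 0 = 1 := by
  rw [pX, Finset.sum_range_succ']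
  simp

theorem pexp (x : L) (hx : IsNilpotent (ad K L x)) :
    ∃ φ : L ≃ₗ⁅K⁆ L, (∀ v, φ v = pX K L (ad K L x) v) ∧ ∀ v, φ.symm v = pX K L (ad K L (-x)) v := by
  letI : Module ℚ L := Module.compHom L (algebraMap ℚ K)
  letI : LieAlgebra ℚ L :=
    { lie_smul := fun q a b => by
        rw [← Rat.cast_smul_eq_qsmul K, lie_smul, Rat.cast_smul_eq_qsmul K] }
  have h1 : (LieDerivation.ad K L x).toLinearMap = ad K L x := by
    ext v; simp
  have h2 : IsNilpotent (LieDerivation.ad K L x).toLinearMap := by rw [h1]; exact hx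
  have h3 : ∀ v, LieDerivation.exp _ h2 v = pX K L (ad K L x) v := by
    intro v
    rw [LieDerivation.exp_map_apply, h1, pX_exp _ hx]
  refine ⟨LieDerivation.exp _ h2, h3, ?_⟩
  intro v
  apply (LieDerivation.exp _ h2).injective
  change LieDerivation.exp _ h2 ((LieDerivation.exp _ h2).symm v) = LieDerivation.exp _ h2 (pX K L (ad K L (-x)) v)
  rw [LieEquiv.apply_symm_apply, h3, ← Module.End.mul_apply, ← pX_add, map_neg, add_neg_cancel, pX_zero]
  · rfl
  · exact hx
  · rw [map_neg]; exact hx.neg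
  · rw [map_neg]; exact (Commute.refl _).neg_right

theorem pX_conj (σ : L ≃ₗ⁅K⁆ L) (x v : L) :
    σ (pX K L (ad K L x) v) = pX K L (ad K L (σ x)) (σ v) := by
  have h : ∀ n : ℕ, σ ((ad K L x ^ n) v) = (ad K L (σ x) ^ n) (σ v) := by
    intro n
    induction n with
    | zero => rfl
    | succ n ih =>
      rw [pow_succ', pow_succ', Module.End.mul_apply, Module.End.mul_apply, ad_apply, ad_apply,
        LieEquiv.map_lie, ih]
  simp only [pX, LinearMap.sum_apply, LinearMap.smul_apply]
  rw [map_sum]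
  refine Finset.sum_congr rfl fun i _ => ?_
  rw [map_smul, h]

theorem pcartan_map (φ : L ≃ₗ⁅K⁆ L) (C : LieSubalgebra K L) (hC : C.IsCartanSubalgebra) :
    (C.map (φ : L →ₗ⁅K⁆ L)).IsCartanSubalgebra := by
  have hm : ∀ x, x ∈ C.map (φ : L →ₗ⁅K⁆ L) ↔ φ.symm x ∈ C := by
    intro x
    rw [LieSubalgebra.mem_map]
    constructor
    · rintro ⟨y, hy, rfl⟩
      simpa using hy
    · intro h
      exact ⟨_, h, by simp⟩
  constructor
  · exact (LieEquiv.nilpotent_iff_equiv_nilpotent (φ.lieSubalgebraMap C)).1 hC.nilpotent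
  · refine le_antisymm ?_ (LieSubalgebra.le_normalizer _)
    intro x hx
    rw [hm]
    rw [← hC.self_normalizing, LieSubalgebra.mem_normalizer_iff]
    intro y hy
    rw [LieSubalgebra.mem_normalizer_iff] at hx
    have := hx (φ y) ((hm _).2 (by simpa using hy))
    rw [hm, LieEquiv.map_lie] at this
    simpa using this

variable (K L) in
def pSd (d : ℕ) : Set (L ≃ₗ⁅K⁆ L) :=
  {σ | ∃ C : LieSubalgebra K L, C.IsCartanSubalgebra ∧ finrank K C = d ∧ ∀ x, x ∈ C ↔ σ x = x}

theorem pSd_conj (d : ℕ) (σ φ : L ≃ₗ⁅K⁆ L) (h : σ ∈ pSd K L d) :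
    (φ.symm.trans σ).trans φ ∈ pSd K L d := by
  obtain ⟨C, hC, hd, hx⟩ := h
  refine ⟨C.map (φ : L →ₗ⁅K⁆ L), pcartan_map φ C hC, ?_, ?_⟩
  · rw [← hd]
    exact (φ.lieSubalgebraMap C).toLinearEquiv.finrank_eq.symm
  · intro x
    rw [LieSubalgebra.mem_map]
    constructor
    · rintro ⟨y, hy, rfl⟩
      have := (hx y).1 hy
      simp [LieEquiv.trans_apply, this]
    · intro h
      refine ⟨φ.symm x, ?_, by simp⟩
      rw [hx]
      rw [LieEquiv.trans_apply, LieEquiv.trans_apply] at h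
      apply φ.injective
      change φ (σ (φ.symm x)) = φ (φ.symm x)
      rw [h, LieEquiv.apply_symm_apply]
end partA4

section partA5
variable {K L : Type*} [Field K] [CharZero K] [IsAlgClosed K] [LieRing L] [LieAlgebra K L]
  [FiniteDimensional K L]

variable (K L) in
noncomputable def pm : Module.End K L →ₐ[K] Matrix (Fin (finrank K L)) (Fin (finrank K L)) K :=
  (LinearMap.toMatrixAlgEquiv (finBasis K L)).toAlgHom

def pc (σ : L ≃ₗ⁅K⁆ L) : Module.End K L := (σ.toLinearEquiv : L →ₗ[K] L)

theorem pc_apply (σ : L ≃ₗ⁅K⁆ L) (x : L) : pc σ x = σ x := rfl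

variable (K L) in
def pJ (d : ℕ) : Set (MvPolynomial (Fin (finrank K L) × Fin (finrank K L)) K) :=
  {F | ∀ σ ∈ pSd K L d, paE (pm K L (pc σ)) F = 0}

theorem pm_X (f : Module.End K L) : pm K L (pX K L f) =
    ∑ i ∈ Finset.range (finrank K L + 1), (i.factorial : K)⁻¹ • (pm K L f) ^ i := by
  rw [pX, map_sum]
  refine Finset.sum_congr rfl fun i _ => ?_
  rw [map_smul, map_pow]

variable [LieAlgebra.IsKilling K L] {H : LieSubalgebra K L} [H.IsCartanSubalgebra]

theorem p_root (σ : L ≃ₗ⁅K⁆ L) (hσ : ∀ x, x ∈ H ↔ σ x = x) (α : Weight K H L) (hα : α.IsNonZero) :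
    ∃ χ : K, χ ≠ 1 ∧ ∀ x ∈ rootSpace H α, σ x = χ • x := by
  obtain ⟨e, he, he0⟩ := α.exists_ne_zero
  have hσe : σ e ∈ rootSpace H α := by
    refine pe_mem _ _ fun y => ?_
    have h1 := lie_eq_smul_of_mem_rootSpace he y
    rw [LieSubalgebra.coe_bracket_of_module] at h1
    have h2 := congrArg σ h1
    rw [LieEquiv.map_lie, (hσ y).1 y.2, map_smul] at h2
    exact h2
  obtain ⟨χ, hχ⟩ := pd_exists_smul hα he he0 hσe
  refine ⟨χ, ?_, ?_⟩
  · rintro rfl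
    rw [one_smul] at hχ
    have heH : e ∈ H := (hσ e).2 hχ
    apply hα
    ext y
    have h1 := lie_eq_smul_of_mem_rootSpace he y
    have h2 : ⁅y, (⟨e, heH⟩ : H)⁆ = 0 := trivial_lie_zero H H y _
    have h3 : ⁅(y : L), e⁆ = 0 := congrArg Subtype.val h2
    rw [LieSubalgebra.coe_bracket_of_module, h3] at h1
    exact (smul_eq_zero.1 h1.symm).resolve_right he0
  · intro x hx
    obtain ⟨c, rfl⟩ := pd_exists_smul hα he he0 hx
    rw [map_smul, hχ, smul_comm]

theorem pJi (d : ℕ) (σ : L ≃ₗ⁅K⁆ L) (hd : σ ∈ pSd K L d) (hσ : ∀ x, x ∈ H ↔ σ x = x)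
    (α : Weight K H L) (hα : α.IsNonZero) (e : L) (he : e ∈ rootSpace H α)
    (F) (hF : F ∈ pJ K L d) : paE (pm K L (pc σ)) (paL (pm K L (ad K L e)) F) = 0 := by
  obtain ⟨χ, hχ1, hχ⟩ := p_root σ hσ α hα
  have hnil : IsNilpotent (ad K L e) := isNilpotent_ad_of_mem_rootSpace H hα he
  refine pa2 (finrank K L + 1) (Nat.succ_pos _) _ _ (by rw [← map_pow, pnil_pow _ hnil, map_zero]) F ?_
  intro s
  set t := s / (1 - χ) with ht
  have h1χ : 1 - χ ≠ 0 := sub_ne_zero.2 hχ1.symm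
  have hnt : ∀ c : K, IsNilpotent (ad K L (c • e)) := fun c => by
    rw [map_smul]; exact hnil.smul c
  obtain ⟨φ, h1, h2⟩ := pexp (t • e) (hnt t)
  have h3 := hF _ (pSd_conj d σ φ hd)
  rw [← map_smul (pm K L), ← pm_X, ← map_mul]
  convert h3 using 3
  congr 1
  ext v
  rw [Module.End.mul_apply, pc_apply, pc_apply, LieEquiv.trans_apply, LieEquiv.trans_apply, h2,
    pX_conj, h1, ← Module.End.mul_apply, ← pX_add]
  · congr 2
    rw [map_neg, map_smul σ, hχ e he, ← map_smul, ← map_add]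
    congr 1
    rw [smul_smul, ← sub_eq_add_neg, ← sub_smul]
    congr 1
    rw [ht]; field_simp
  · exact hnt t
  · rw [map_neg, map_smul σ, hχ e he, smul_smul, ← neg_smul]; exact hnt _
  · rw [map_neg, map_smul σ, hχ e he, smul_smul, ← neg_smul, map_smul, map_smul]
    exact ((Commute.refl _).smul_left _).smul_right _

theorem p_fix (φ : Module.End K L) (h0 : ∀ x ∈ H, φ x = x) (χ : Weight K H L → K)
    (h1 : ∀ α : Weight K H L, α.IsNonZero → χ α ≠ 1 ∧ ∀ x ∈ rootSpace H α, φ x = χ α • x)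
    (x : L) (hx : φ x = x) : x ∈ H := by
  refine pfix (φ - 1) H.toSubmodule (fun α : {α : Weight K H L // α.IsNonZero} => (rootSpace H α.1).toSubmodule)
    ?_ (fun α => χ α.1 - 1) (fun α => sub_ne_zero.2 (h1 α.1 α.2).1) ?_ ?_ x (by simp [hx])
  · rw [eq_top_iff]
    intro v _
    refine pe_top_le (H := H) _ ?_ ?_ v
    · intro x hx
      exact Submodule.mem_sup_left hx
    · intro α hα x hx
      exact Submodule.mem_sup_right (Submodule.mem_iSup_of_mem (⟨α, hα⟩ : {α : Weight K H L // α.IsNonZero}) hx)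
  · rintro ⟨α, hα⟩ x hx
    rw [LinearMap.sub_apply, (h1 α hα).2 x hx, sub_smul, one_smul]; rfl
  · intro x hx
    rw [LinearMap.sub_apply, h0 x hx]; simp
end partA5

section partA6
variable {K L : Type*} [Field K] [CharZero K] [IsAlgClosed K] [LieRing L] [LieAlgebra K L]
  [FiniteDimensional K L]
variable [LieAlgebra.IsKilling K L] {H : LieSubalgebra K L} [H.IsCartanSubalgebra]

theorem p_int (β : Weight K H L) (a : K) (ha : a ∈ pS (ad K L (coroot β : L))) : ∃ n : ℤ, a = n := by
  classical
  by_contra hcon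
  push Not at hcon
  rw [pS, Multiset.mem_toFinset, Polynomial.mem_roots (LinearMap.charpoly_monic _).ne_zero,
    ← Module.End.hasEigenvalue_iff_isRoot_charpoly] at ha
  obtain ⟨v, hv⟩ := ha.exists_hasEigenvector
  apply hv.2
  have htop' : (⨆ χ : Weight K H L, (genWeightSpace L χ : LieSubmodule K H L).toSubmodule) = ⊤ := by
    rw [← LieSubmodule.iSup_toSubmodule, LieModule.iSup_genWeightSpace_eq_top' K H L]; rfl
  have := pfix (ad K L (coroot β : L) - a • 1) ⊥
    (fun χ : Weight K H L => (genWeightSpace L χ : LieSubmodule K H L).toSubmodule) (by rw [htop']; simp)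
    (fun χ => χ (coroot β) - a) (fun χ => ?_) ?_ (by simp) v ?_
  · simpa using this
  · rw [apply_coroot_eq_cast]
    exact sub_ne_zero.2 (hcon _).symm
  · intro χ x hx
    have h1 := lie_eq_smul_of_mem_rootSpace (H := H) (α := χ) hx (coroot β)
    rw [LieSubalgebra.coe_bracket_of_module] at h1
    rw [LinearMap.sub_apply, ad_apply, h1, sub_smul]; rfl
  · rw [LinearMap.sub_apply, hv.apply_eq_smul]; simp

noncomputable def pnu : K → ℤ := Function.invFun (fun n : ℤ => (n : K))

theorem pnu_cast (n : ℤ) : pnu (n : K) = n :=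
  Function.leftInverse_invFun (f := fun n : ℤ => (n : K)) Int.cast_injective n

open Classical in
theorem p_bad (χ : K) (n : ℤ) (h1 : χ ≠ 1) (c : K) (hc : c ≠ 0) (h : c ^ n * χ = 1) :
    c ∈ (Polynomial.nthRoots n.natAbs χ).toFinset ∪ (Polynomial.nthRoots n.natAbs χ⁻¹).toFinset := by
  have hn : n ≠ 0 := by
    rintro rfl
    simp at h; exact h1 h
  have hpos : 0 < n.natAbs := Int.natAbs_pos.2 hn
  rw [Finset.mem_union, Multiset.mem_toFinset, Multiset.mem_toFinset, Polynomial.mem_nthRoots hpos,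
    Polynomial.mem_nthRoots hpos]
  have h2 : c ^ n = χ⁻¹ := eq_inv_of_mul_eq_one_left h
  rcases Int.natAbs_eq n with h3 | h3
  · right
    rw [h3, zpow_natCast] at h2
    exact h2
  · left
    rw [h3, zpow_neg, zpow_natCast] at h2
    exact inv_injective h2

open Classical in
theorem pJii (d : ℕ) (σ : L ≃ₗ⁅K⁆ L) (hd : finrank K H = d) (hσ : ∀ x, x ∈ H ↔ σ x = x)
    (β : Weight K H L)
    (F) (hF : F ∈ pJ K L d) : paE (pm K L (pc σ)) (paL (pm K L (ad K L (coroot β : L))) F) = 0 := by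
  set f := ad K L (coroot β : L) with hf
  have hss : f.IsSemisimple := isSemisimple_ad_of_mem_isCartanSubalgebra (coroot β).2
  have hroot : ∀ α : Weight K H L, ∃ χ : K, α.IsNonZero → χ ≠ 1 ∧ ∀ x ∈ rootSpace H α, σ x = χ • x := by
    intro α
    by_cases hα : α.IsNonZero
    · obtain ⟨χ, h⟩ := p_root σ hσ α hα
      exact ⟨χ, fun _ => h⟩
    · exact ⟨0, fun h => absurd h hα⟩
  choose χ hχ using hroot
  have key := pa3 (pS f) pnu (fun a => pm K L (pP f a) * pm K L (pc σ)) (pm K L f) ?_ F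
    (Finset.univ.biUnion fun α : Weight K H L =>
      (Polynomial.nthRoots (pnu (α (coroot β))).natAbs (χ α)).toFinset ∪
        (Polynomial.nthRoots (pnu (α (coroot β))).natAbs (χ α)⁻¹).toFinset) ?_
  · rw [← Finset.sum_mul, ← map_sum, pP_sum f hss, map_one, one_mul] at key
    exact key
  · intro a ha
    obtain ⟨n, rfl⟩ := p_int β a ha
    rw [← map_mul, ← map_mul, ← mul_assoc, pP_mul f hss _ ha, pnu_cast, smul_mul_assoc, map_smul]
  · intro c hc hcB
    obtain ⟨T, hT⟩ := pt (coroot β : L) hss (fun a => c ^ pnu a) (fun a => zpow_ne_zero _ hc) (by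
      intro a b ha hb _
      obtain ⟨n, rfl⟩ := p_int β a ha
      obtain ⟨m, rfl⟩ := p_int β b hb
      rw [← Int.cast_add, pnu_cast, pnu_cast, pnu_cast, zpow_add₀ hc])
    have hTH : ∀ x ∈ H, T x = x := by
      intro x hx
      rw [hT, pT_apply _ _ (0 : K)]
      · have : pnu (0 : K) = 0 := by simpa using pnu_cast (K := K) 0
        rw [this]; simp
      · have h2 : ⁅coroot β, (⟨x, hx⟩ : H)⁆ = 0 := trivial_lie_zero H H _ _
        have h3 : ⁅(coroot β : L), x⁆ = 0 := congrArg Subtype.val h2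
        rw [ad_apply, h3, zero_smul]
    have hTr : ∀ α : Weight K H L, ∀ x ∈ rootSpace H α, T x = c ^ pnu (α (coroot β)) • x := by
      intro α x hx
      rw [hT, pT_apply _ _ (α (coroot β))]
      have h1 := lie_eq_smul_of_mem_rootSpace (H := H) (α := α) hx (coroot β)
      rw [LieSubalgebra.coe_bracket_of_module] at h1
      exact h1
    have hmem : σ.trans T ∈ pSd K L d := by
      refine ⟨H, inferInstance, hd, fun x => ⟨fun hx => ?_, fun hx => ?_⟩⟩
      · rw [LieEquiv.trans_apply, (hσ x).1 hx, hTH x hx]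
      · refine p_fix (H := H) (pc (σ.trans T)) ?_ (fun α => c ^ pnu (α (coroot β)) * χ α) ?_ x hx
        · intro x hx
          rw [pc_apply, LieEquiv.trans_apply, (hσ x).1 hx, hTH x hx]
        · intro α hα
          refine ⟨fun h => hcB ?_, ?_⟩
          · exact Finset.mem_biUnion.2 ⟨α, Finset.mem_univ _, p_bad _ _ (hχ α hα).1 c hc h⟩
          · intro x hx
            rw [pc_apply, LieEquiv.trans_apply, (hχ α hα).2 x hx, map_smul, hTr α x hx, smul_smul, mul_comm]
    have h3 := hF _ hmem
    convert h3 using 3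
    simp only [← map_mul, ← map_smul, ← map_sum]
    congr 1
    ext v
    rw [pc_apply, LieEquiv.trans_apply, hT, pT]
    simp only [LinearMap.sum_apply, LinearMap.smul_apply, Module.End.mul_apply, pc_apply, hf]

theorem pJ_stable (d : ℕ) (z : L) (F) (hF : F ∈ pJ K L d) : paL (pm K L (ad K L z)) F ∈ pJ K L d := by
  intro σ hσ
  obtain ⟨C, hC, hd, hx⟩ := id hσ
  let S : Submodule K L :=
    { carrier := {z | paE (pm K L (pc σ)) (paL (pm K L (ad K L z)) F) = 0}
      add_mem' := fun {a b} ha hb => by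
        simp only [Set.mem_setOf_eq] at ha hb ⊢
        rw [map_add, map_add, paL_add, Derivation.add_apply, map_add, ha, hb, add_zero]
      zero_mem' := by
        have := paL_smul (K := K) 0 (pm K L (ad K L 0))
        rw [zero_smul, zero_smul] at this
        simp [this]
      smul_mem' := fun c a ha => by
        simp only [Set.mem_setOf_eq] at ha ⊢
        rw [map_smul, map_smul, paL_smul, Derivation.smul_apply, map_smul, ha, smul_zero] }
  refine pe_top_le (H := C) S ?_ ?_ z
  · intro x hxC
    have h1 : Submodule.span K (Set.range (rootSystem C).coroot) ≤ S.comap C.toSubmodule.subtype := by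
      rw [Submodule.span_le]
      rintro _ ⟨α, rfl⟩
      rw [rootSystem_coroot_apply]
      exact pJii d σ hd hx _ F hF
    rw [RootPairing.IsRootSystem.span_coroot_eq_top] at h1
    exact h1 (x := ⟨x, hxC⟩) trivial
  · intro α hα e he
    exact pJi d σ hσ hx α hα e he F hF
end partA6

section partA7
open Polynomial in
theorem p_taylor {K ι : Type*} [Field K] [Fintype ι] [DecidableEq ι] (M : Matrix ι ι K) (i : ℕ) :
    paE M (((Matrix.charpoly.univ K ι).comp (X + C 1)).coeff i) = (M.charpoly.comp (X + C 1)).coeff i := by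
  have h1 := Matrix.charpoly.univ_map_eval₂Hom ι (RingHom.id K) (fun p : ι × ι => M p.1 p.2)
  have h2 : (Matrix.of (Function.curry (fun p : ι × ι => M p.1 p.2))) = M := by ext; rfl
  rw [h2] at h1
  rw [← h1]
  have h3 : (MvPolynomial.eval₂Hom (RingHom.id K) (fun p : ι × ι => M p.1 p.2)) = (paE M : _ →ₐ[K] K).toRingHom := by
    apply MvPolynomial.ringHom_ext <;> intro <;> simp [paE]
  have h4 : (X + C 1 : K[X]) = (X + C 1 : (MvPolynomial (ι × ι) K)[X]).map (paE M : _ →ₐ[K] K).toRingHom := by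
    simp
  rw [h3, h4, ← Polynomial.map_comp, Polynomial.coeff_map]
  rfl

variable {K L : Type*} [Field K] [CharZero K] [IsAlgClosed K] [LieRing L] [LieAlgebra K L]
  [FiniteDimensional K L]

theorem pm_charpoly (f : Module.End K L) : (pm K L f).charpoly = f.charpoly :=
  LinearMap.charpoly_toMatrix f (finBasis K L)

open Polynomial in
theorem p_mult (f : Module.End K L) (d : ℕ) : d ≤ finrank K (f.maxGenEigenspace 1) ↔
    ∀ i < d, paE (pm K L f) (((Matrix.charpoly.univ K (Fin (finrank K L))).comp (X + C 1)).coeff i) = 0 := by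
  have hne : (f.charpoly.comp (X + C 1)) ≠ 0 := ((f.charpoly_monic).comp_X_add_C 1).ne_zero
  rw [Module.End.maxGenEigenspace_eq_maxGenEigenspace_zero, LinearMap.finrank_maxGenEigenspace_zero_eq,
    LinearMap.charpoly_sub_smul]
  simp only [p_taylor, pm_charpoly]
  constructor
  · intro h i hi
    exact coeff_eq_zero_of_lt_natTrailingDegree (lt_of_lt_of_le hi h)
  · intro h
    exact le_natTrailingDegree hne h

variable [LieAlgebra.IsKilling K L]

theorem p_inner (d : ℕ) (μ : L ≃ₗ[K] L) (hμ : μ ∈ Subgroup.closure {e : L ≃ₗ[K] L | ∃ x, IsNilpotent (ad K L x) ∧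
      (e : L →ₗ[K] L) = pX K L (ad K L x)}) (B : Module.End K L) (hB : ∀ F ∈ pJ K L d, paE (pm K L B) F = 0) :
    ∀ F ∈ pJ K L d, paE (pm K L ((μ : L →ₗ[K] L) * B)) F = 0 := by
  have hx : ∀ x : L, IsNilpotent (ad K L x) → ∀ B : Module.End K L, (∀ F ∈ pJ K L d, paE (pm K L B) F = 0) →
      ∀ F ∈ pJ K L d, paE (pm K L (pX K L (ad K L x) * B)) F = 0 := by
    intro x hx B hB F hF
    rw [map_mul, pm_X]
    exact pa4 _ (Nat.succ_pos _) _ _ (by rw [← map_pow, pnil_pow _ hx, map_zero]) (pJ K L d)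
      (fun F hF => pJ_stable d x F hF) hB F hF
  have hmul : ∀ (a b : L ≃ₗ[K] L) (B : Module.End K L), (((a * b : L ≃ₗ[K] L) : L →ₗ[K] L) * B : Module.End K L) =
      (a : L →ₗ[K] L) * ((b : L →ₗ[K] L) * B : Module.End K L) := by
    intro a b B
    ext v
    rfl
  have hone : ∀ (B : Module.End K L), (((1 : L ≃ₗ[K] L) : L →ₗ[K] L) * B : Module.End K L) = B := by
    intro B
    ext v
    rfl
  have main : (∀ B : Module.End K L, (∀ F ∈ pJ K L d, paE (pm K L B) F = 0) →
      ∀ F ∈ pJ K L d, paE (pm K L ((μ : L →ₗ[K] L) * B)) F = 0) ∧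
      (∀ B : Module.End K L, (∀ F ∈ pJ K L d, paE (pm K L B) F = 0) →
      ∀ F ∈ pJ K L d, paE (pm K L (((μ⁻¹ : L ≃ₗ[K] L) : L →ₗ[K] L) * B)) F = 0) := by
    clear hB
    induction hμ using Subgroup.closure_induction with
    | mem e he =>
      obtain ⟨x, hnx, he⟩ := he
      have hinv : ((e⁻¹ : L ≃ₗ[K] L) : L →ₗ[K] L) = pX K L (ad K L (-x)) := by
        ext v
        obtain ⟨φ, h1, h2⟩ := pexp x hnx
        apply e.injective
        have h3 : ∀ u, e u = φ u := fun u => by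
          rw [h1, ← he]; rfl
        rw [← h2, h3 (φ.symm v), LieEquiv.apply_symm_apply]
        exact e.apply_symm_apply v
      refine ⟨?_, ?_⟩
      · rw [he]; exact hx x hnx
      · rw [hinv]; exact hx _ (by rw [map_neg]; exact hnx.neg)
    | one =>
      rw [inv_one]
      refine ⟨fun B hB => ?_, fun B hB => ?_⟩ <;> (rw [hone]; exact hB)
    | mul a b _ _ ha hb =>
      refine ⟨fun B hB => ?_, fun B hB => ?_⟩
      · rw [hmul]
        exact ha.1 _ (hb.1 B hB)
      · rw [mul_inv_rev, hmul]
        exact hb.2 _ (ha.2 B hB)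
    | inv a _ ha =>
      rw [inv_inv]
      exact ⟨ha.2, ha.1⟩
  exact main.1 B hB

theorem pA (d : ℕ) (μ : L ≃ₗ[K] L) (hμ : μ ∈ Subgroup.closure {e : L ≃ₗ[K] L | ∃ x, IsNilpotent (ad K L x) ∧
      (e : L →ₗ[K] L) = pX K L (ad K L x)}) (σ : L ≃ₗ⁅K⁆ L) (hσ : σ ∈ pSd K L d) :
    d ≤ finrank K (Module.End.maxGenEigenspace ((μ : L →ₗ[K] L) * pc σ : Module.End K L) 1) := by
  rw [p_mult]
  intro i hi
  refine p_inner d μ hμ (pc σ) (fun F hF => hF σ hσ) _ ?_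
  intro τ hτ
  refine (p_mult (pc τ) d).1 ?_ i hi
  obtain ⟨C, hC, hd, hx⟩ := hτ
  rw [← hd]
  refine Submodule.finrank_mono (s := C.toSubmodule) ?_
  refine le_trans ?_ Module.End.eigenspace_le_maxGenEigenspace
  intro x hxC
  rw [Module.End.mem_eigenspace_iff, pc_apply, (hx x).1 hxC, one_smul]
end partA7

section partB1
variable {K L : Type*} [Field K] [IsAlgClosed K] [CharZero K] [LieRing L] [LieAlgebra K L]
  [FiniteDimensional K L] [LieAlgebra.IsKilling K L]

theorem pad_inj (K : Type*) {L : Type*} [Field K] [IsAlgClosed K] [CharZero K] [LieRing L] [LieAlgebra K L]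
  [FiniteDimensional K L] [LieAlgebra.IsKilling K L] (x : L) (h : ∀ v : L, ⁅x, v⁆ = 0) : x = 0 := by
  have : x ∈ LieAlgebra.center K L := by
    rw [LieModule.mem_maxTrivSubmodule]
    intro v
    rw [← lie_skew, h, neg_zero]
  rw [LieAlgebra.center_eq_bot] at this
  simpa using this

open Module.End in
theorem pjord (x : L) : ∃ s : L, (ad K L s).IsSemisimple ∧ IsNilpotent (ad K L (x - s)) ∧
    ∀ D : Module.End K L, Commute D (ad K L x) → Commute D (ad K L s) := by
  obtain ⟨N, -, S, hS₁, hN, hS, hSN⟩ := (ad K L x).exists_isNilpotent_isSemisimple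
  have hS₀ : Commute (ad K L x) S := Algebra.commute_of_mem_adjoin_self hS₁
  have hN' : IsNilpotent ((ad K L x) - S) := by rwa [eq_sub_of_add_eq hSN.symm] at hN
  have aux {a : K} {y : L} (hy : y ∈ (ad K L x).maxGenEigenspace a) : S y = a • y := by
    rw [maxGenEigenspace_eq] at hy
    rw [apply_eq_of_mem_of_comm_of_isFinitelySemisimple_of_isNil hy hS₀ hS.isFinitelySemisimple hN']
  have h_der (y z : L) (α β : K) (hy : y ∈ (ad K L x).maxGenEigenspace α)
      (hz : z ∈ (ad K L x).maxGenEigenspace β) :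
      S ⁅y, z⁆ = ⁅S y, z⁆ + ⁅y, S z⁆ := by
    have hyz : ⁅y, z⁆ ∈ (ad K L x).maxGenEigenspace (α + β) :=
      lie_mem_maxGenEigenspace_toEnd hy hz
    rw [aux hy, aux hz, aux hyz, smul_lie, lie_smul, ← add_smul]
  replace h_der (y z : L) : S ⁅y, z⁆ = ⁅S y, z⁆ + ⁅y, S z⁆ := by
    have hy : y ∈ ⨆ α : K, (ad K L x).maxGenEigenspace α := by
      rw [Module.End.iSup_maxGenEigenspace_eq_top]; trivial
    have hz : z ∈ ⨆ α : K, (ad K L x).maxGenEigenspace α := by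
      rw [Module.End.iSup_maxGenEigenspace_eq_top]; trivial
    induction hy using Submodule.iSup_induction' with
    | mem α y hy =>
      induction hz using Submodule.iSup_induction' with
      | mem β z hz => exact h_der y z α β hy hz
      | zero => simp
      | add _ _ _ _ h h' => simp only [lie_add, map_add, h, h']; abel
    | zero => simp
    | add _ _ _ _ h h' => simp only [add_lie, map_add, h, h']; abel
  replace h_der : ∀ y z : L, S ⁅y, z⁆ = ⁅y, S z⁆ - ⁅z, S y⁆ := by
    simp_rw [← lie_skew (S _) _, add_comm, ← sub_eq_add_neg] at h_der; assumption
  let S' : LieDerivation K L L := ⟨S, h_der⟩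
  obtain ⟨y, hy⟩ := LieDerivation.IsKilling.exists_eq_ad S'
  have hyS : ad K L y = S := by
    rw [← LieDerivation.coe_ad_apply_eq_ad_apply y, hy]
  refine ⟨y, hyS ▸ hS, ?_, fun D hD => ?_⟩
  · rw [map_sub, hyS]; exact hN'
  · rw [hyS]
    exact Algebra.commute_of_mem_adjoin_singleton_of_commute hS₁ hD
end partB1

section partB2
theorem pst1 {K V : Type*} [Field K] [IsAlgClosed K] [CharZero K] [AddCommGroup V] [Module K V]
    [FiniteDimensional K V] (A B : Module.End K V) (hA : A.IsSemisimple) (hB : B.IsSemisimple)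
    (hAB : Commute A B) :
    ∃ c : K, (A + c • B).IsSemisimple ∧ ∀ v, (A + c • B) v = 0 → A v = 0 ∧ B v = 0 := by
  classical
  obtain ⟨c, hc⟩ := Infinite.exists_notMem_finset
    ((pS A ×ˢ pS B).image (fun p : K × K => -p.1 / p.2))
  have hcB : (c • B).IsSemisimple := by
    have h := Module.End.IsSemisimple.aeval hB (Polynomial.C c * Polynomial.X)
    simpa [Algebra.smul_def] using h
  have hcomm : Commute A (c • B) := hAB.smul_right c
  refine ⟨c, Module.End.IsSemisimple.add_of_commute hcomm hA hcB, fun v hv => ?_⟩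
  have key : ∀ b ∈ pS B, A (pP B b v) = 0 ∧ B (pP B b v) = 0 := by
    intro b hb
    have h1 : B (pP B b v) = b • pP B b v := by
      have := LinearMap.congr_fun (pP_mul B hB b hb) v
      simpa using this
    have hcp : Commute (A + c • B) (pP B b) := by
      have : Commute B (A + c • B) := (hAB.symm).add_right ((Commute.refl B).smul_right c)
      exact (Algebra.commute_of_mem_adjoin_singleton_of_commute (Polynomial.aeval_mem_adjoin_singleton K B) this.symm)
    have h2 : (A + c • B) (pP B b v) = 0 := by
      have := LinearMap.congr_fun hcp.eq v
      simp only [Module.End.mul_apply] at this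
      rw [this, hv, map_zero]
    have h3 : A (pP B b v) = (-(c * b)) • pP B b v := by
      simp only [LinearMap.add_apply, LinearMap.smul_apply, h1] at h2
      rw [neg_smul, mul_smul]; exact eq_neg_of_add_eq_zero_left h2
    by_cases h0 : pP B b v = 0
    · simp [h0]
    by_cases hb0 : b = 0
    · subst hb0; simp [h1, h3]
    exfalso
    apply hc
    rw [Finset.mem_image]
    refine ⟨(-(c*b), b), Finset.mem_product.2 ⟨pS_mem A _ _ h3 h0, hb⟩, ?_⟩
    simp only; field_simp
  have hs : v = ∑ b ∈ pS B, pP B b v := by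
    have := LinearMap.congr_fun (pP_sum B hB) v
    simpa using this.symm
  constructor
  · rw [hs, map_sum]; exact Finset.sum_eq_zero fun b hb => (key b hb).1
  · rw [hs, map_sum]; exact Finset.sum_eq_zero fun b hb => (key b hb).2
end partB2

section partB3
variable {K L : Type*} [Field K] [IsAlgClosed K] [CharZero K] [LieRing L] [LieAlgebra K L]
  [FiniteDimensional K L] [LieAlgebra.IsKilling K L]

theorem pad_comm (y x : L) (h : ⁅y, x⁆ = 0) : Commute (ad K L y) (ad K L x) := by
  ext v
  simp only [Module.End.mul_apply, ad_apply]
  rw [leibniz_lie, h, zero_lie, zero_add]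

theorem pmin (mu : L ≃ₗ⁅K⁆ L) : ∃ y : L, mu y = y ∧ (ad K L y).IsSemisimple ∧
    ∀ x, mu x = x → (ad K L x).IsSemisimple → ⁅y, x⁆ = 0 → ∀ v : L, ⁅y, v⁆ = 0 → ⁅x, v⁆ = 0 := by
  let P : ℕ → Prop := fun d => ∃ y : L, mu y = y ∧ (ad K L y).IsSemisimple ∧
    finrank K (LinearMap.ker (ad K L y)) = d
  have hP : ∃ d, P d := ⟨_, 0, map_zero mu, by rw [map_zero]; exact Module.End.isSemisimple_zero, rfl⟩
  classical
  obtain ⟨y, hy1, hy2, hy3⟩ := Nat.find_spec hP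
  refine ⟨y, hy1, hy2, fun x hx hxs hyx v hv => ?_⟩
  obtain ⟨c, hc1, hc2⟩ := pst1 (ad K L y) (ad K L x) hy2 hxs (pad_comm y x hyx)
  have e : ad K L y + c • ad K L x = ad K L (y + c • x) := by simp
  rw [e] at hc1 hc2
  have hle : LinearMap.ker (ad K L (y + c • x)) ≤ LinearMap.ker (ad K L y) := by
    intro v hv; exact (hc2 v hv).1
  have hmin := Nat.find_min' hP ⟨y + c • x, by rw [map_add, map_smul, hy1, hx], hc1, rfl⟩
  rw [← hy3] at hmin
  have heq := Submodule.eq_of_le_of_finrank_le hle hmin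
  have : v ∈ LinearMap.ker (ad K L (y + c • x)) := by rw [heq]; exact hv
  exact (hc2 v this).2

theorem pjord2 (mu : L ≃ₗ⁅K⁆ L) (y x : L) (hx : mu x = x) (hyx : ⁅y, x⁆ = 0) :
    ∃ s : L, (ad K L s).IsSemisimple ∧ IsNilpotent (ad K L (x - s)) ∧ mu s = s ∧ ⁅y, s⁆ = 0 := by
  obtain ⟨s, h1, h2, h3⟩ := pjord (K := K) x
  refine ⟨s, h1, h2, ?_, ?_⟩
  · have hc : Commute (pc mu) (ad K L x) := by
      ext v; simp only [Module.End.mul_apply, pc_apply, ad_apply, LieEquiv.map_lie, hx]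
    have := h3 _ hc
    rw [← sub_eq_zero]
    apply pad_inj K
    intro v
    have h4 := LinearMap.congr_fun this.eq (mu.symm v)
    simp only [Module.End.mul_apply, pc_apply, ad_apply, LieEquiv.map_lie, LieEquiv.apply_symm_apply] at h4
    rw [sub_lie, h4, sub_self]
  · have := h3 _ (pad_comm y x hyx)
    apply pad_inj K
    intro v
    have h4 := LinearMap.congr_fun this.eq v
    simp only [Module.End.mul_apply, ad_apply] at h4
    rw [lie_lie, h4, sub_self]

def pZ0 (mu : L ≃ₗ⁅K⁆ L) (y : L) : LieSubalgebra K L where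
  carrier := {x | mu x = x ∧ ⁅y, x⁆ = 0}
  add_mem' := by rintro a b ⟨h1, h2⟩ ⟨h3, h4⟩; exact ⟨by rw [map_add, h1, h3], by rw [lie_add, h2, h4, add_zero]⟩
  zero_mem' := ⟨map_zero mu, lie_zero y⟩
  smul_mem' := by rintro c a ⟨h1, h2⟩; exact ⟨by rw [map_smul, h1], by rw [lie_smul, h2, smul_zero]⟩
  lie_mem' := by
    rintro a b ⟨h1, h2⟩ ⟨h3, h4⟩
    exact ⟨by rw [LieEquiv.map_lie, h1, h3], by rw [leibniz_lie, h2, h4, zero_lie, lie_zero, add_zero]⟩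

theorem pZ0_nil (mu : L ≃ₗ⁅K⁆ L) (y : L) 
    (hy : ∀ x, mu x = x → (ad K L x).IsSemisimple → ⁅y, x⁆ = 0 → ∀ v : L, ⁅y, v⁆ = 0 → ⁅x, v⁆ = 0) :
    LieRing.IsNilpotent (pZ0 mu y) := by
  rw [LieAlgebra.isNilpotent_iff_forall (R := K)]
  rintro ⟨x, hx1, hx2⟩
  obtain ⟨s, h1, ⟨m, hm⟩, h3, h4⟩ := pjord2 mu y x hx1 hx2
  refine ⟨m, ?_⟩
  have key : ∀ (i : ℕ) (v : pZ0 mu y), (((ad K (pZ0 mu y) ⟨x, hx1, hx2⟩) ^ i) v : L) =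
      ((ad K L (x - s)) ^ i) v := by
    intro i
    induction i with
    | zero => intro v; simp
    | succ i ih =>
      intro v
      rw [pow_succ', Module.End.mul_apply, pow_succ', Module.End.mul_apply, ← ih]
      set w := ((ad K (pZ0 mu y) ⟨x, hx1, hx2⟩) ^ i) v
      have : ⁅s, (w : L)⁆ = 0 := hy s h3 h1 h4 _ w.2.2
      simp [sub_lie, this]
  ext v
  rw [key, hm]; simp

theorem pZ0_ss (mu : L ≃ₗ⁅K⁆ L) (h2 : ∀ x, mu (mu x) = x) (y : L) (hmy : mu y = y) (hys : (ad K L y).IsSemisimple)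
    (hy : ∀ x, mu x = x → (ad K L x).IsSemisimple → ⁅y, x⁆ = 0 → ∀ v : L, ⁅y, v⁆ = 0 → ⁅x, v⁆ = 0)
    (x : L) (hx1 : mu x = x) (hx2 : ⁅y, x⁆ = 0) : (ad K L x).IsSemisimple := by
  obtain ⟨s, h1, hm, h3, h4⟩ := pjord2 mu y x hx1 hx2
  have hnil := pZ0_nil mu y hy
  set n := x - s with hn
  have hn1 : mu n = n := by rw [hn, map_sub, hx1, h3]
  have hn2 : ⁅y, n⁆ = 0 := by rw [hn, lie_sub, hx2, h4, sub_zero]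
  have hk0 : ∀ v, mu v = v → ⁅y, v⁆ = 0 → killingForm K L n v = 0 := by
    intro v hv1 hv2
    have h := LieModule.traceForm_eq_sum_finrank_nsmul_mul K (pZ0 mu y) L ⟨n, hn1, hn2⟩ ⟨v, hv1, hv2⟩
    have hz : ∀ χ : Weight K (pZ0 mu y) L, χ ⟨n, hn1, hn2⟩ = 0 := by
      intro χ
      have h5 := χ.hasEigenvalueAt ⟨n, hn1, hn2⟩
      have h6 : IsNilpotent (toEnd K (pZ0 mu y) L ⟨n, hn1, hn2⟩) := hm
      exact (h5.isNilpotent_of_isNilpotent h6).eq_zero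
    simp only [hz, zero_mul, smul_zero, Finset.sum_const_zero] at h
    exact h
  have hk : ∀ v, killingForm K L n v = 0 := by
    intro v
    refine pss_ind (ad K L y) hys (LinearMap.ker (killingForm K L n)) ?_ v
    intro a v hv
    rw [LinearMap.mem_ker]
    by_cases ha : a = 0
    · subst ha
      have hv0 : ⁅y, v⁆ = 0 := by simpa using hv
      have h5 := hk0 (v + mu v) (by rw [map_add, h2, add_comm]) (by
        rw [lie_add, hv0, zero_add]
        have := congrArg mu hv0
        rwa [LieEquiv.map_lie, hmy, map_zero] at this)
      have h6 : killingForm K L n (mu v) = killingForm K L n v := by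
        conv_lhs => rw [← hn1]
        exact LieAlgebra.killingForm_of_equiv_apply mu n v
      rw [map_add, h6, ← two_mul] at h5
      simpa using h5
    · have h5 : killingForm K L n ⁅y, v⁆ = 0 := by
        rw [← LieModule.traceForm_apply_lie_apply, ← lie_skew, hn2]; simp
      rw [ad_apply] at hv
      rw [hv, map_smul, smul_eq_mul] at h5
      exact (mul_eq_zero.1 h5).resolve_left ha
  have h0 : n = 0 := by
    have : n ∈ LinearMap.ker (killingForm K L) := by
      rw [LinearMap.mem_ker]; ext v; exact hk v
    rw [LieAlgebra.IsKilling.ker_killingForm_eq_bot] at this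
    simpa using this
  rw [sub_eq_zero.1 h0]; exact h1

theorem pB (mu : L ≃ₗ⁅K⁆ L) (h2 : ∀ x, mu (mu x) = x) : ∃ y, mu y = y ∧ (ad K L y).IsSemisimple ∧
    (LieSubalgebra.engel K y).IsCartanSubalgebra ∧ ∀ x, x ∈ LieSubalgebra.engel K y ↔ ⁅y,x⁆ = 0 := by
  obtain ⟨y, hmy, hys, hy⟩ := pmin mu
  have hmem : ∀ x, x ∈ LieSubalgebra.engel K y ↔ ⁅y,x⁆ = 0 := by
    intro x
    have : x ∈ LieSubalgebra.engel K y ↔ x ∈ (ad K L y).maxGenEigenspace 0 := Iff.rfl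
    rw [this, hys.isFinitelySemisimple.maxGenEigenspace_eq_eigenspace, Module.End.mem_eigenspace_iff]
    simp
  have hcen : ∀ x, mu x = x → ⁅y, x⁆ = 0 → ∀ v : L, ⁅y, v⁆ = 0 → ⁅x, v⁆ = 0 := fun x hx1 hx2 v hv =>
    hy x hx1 (pZ0_ss mu h2 y hmy hys hy x hx1 hx2) hx2 v hv
  have hmuz : ∀ x, ⁅y, x⁆ = 0 → ⁅y, mu x⁆ = 0 := by
    intro x hx
    have := congrArg mu hx
    rwa [LieEquiv.map_lie, hmy, map_zero] at this
  have hzz : ∀ u v : L, ⁅y, u⁆ = 0 → ⁅y, v⁆ = 0 → ⁅y, ⁅u, v⁆⁆ = 0 := by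
    intro u v hu hv
    rw [leibniz_lie, hu, hv, zero_lie, lie_zero, add_zero]
  have hS : ∀ u v : L, ⁅y, u⁆ = 0 → ⁅y, v⁆ = 0 → ⁅mu u, v⁆ = - ⁅u, v⁆ := by
    intro u v hu hv
    have := hcen (u + mu u) (by rw [map_add, h2, add_comm]) (by rw [lie_add, hu, hmuz u hu, add_zero]) v hv
    rw [add_lie] at this
    exact eq_neg_of_add_eq_zero_right this
  have hS2 : ∀ u v : L, ⁅y, u⁆ = 0 → ⁅y, v⁆ = 0 → mu ⁅u, v⁆ = ⁅u, v⁆ := by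
    intro u v hu hv
    rw [LieEquiv.map_lie, hS u _ hu (hmuz v hv), ← lie_skew u, neg_neg, hS v u hv hu, lie_skew]
  refine ⟨y, hmy, hys, ⟨?_, LieSubalgebra.normalizer_engel K y⟩, hmem⟩
  show LieRing.IsNilpotent (LieSubalgebra.engel K y)
  rw [LieAlgebra.isNilpotent_iff_forall (R := K)]
  rintro ⟨u, hu⟩
  refine ⟨2, ?_⟩
  ext ⟨v, hv⟩
  rw [hmem] at hu hv
  have : ⁅u, ⁅u, v⁆⁆ = 0 := by
    rw [← lie_skew, hcen _ (hS2 u v hu hv) (hzz u v hu hv) u hu, neg_zero]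
  simpa [pow_two] using this
end partB3

section partC
theorem pc_int {K : Type*} [Field K] [CharZero K] (S : Finset K) :
    ∃ e : K → ℤ, e 0 = 0 ∧ (∀ a ∈ S, e a = 0 → a = 0) ∧
      ∀ a ∈ S, ∀ b ∈ S, a + b ∈ S → e (a + b) = e a + e b := by
  classical
  obtain ⟨f, hf⟩ : ∃ f : Module.Dual ℚ K, ∀ a ∈ S.filter (· ≠ 0), f a ≠ 0 := by
    obtain ⟨f, hf⟩ := Module.exists_dual_forall_apply_ne_zero (K := ℚ) (M := K)
      (v := fun a : (S.filter (· ≠ 0) : Finset K) => (a : K)) (fun a => (Finset.mem_filter.1 a.2).2)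
    exact ⟨f, fun a ha => hf ⟨a, ha⟩⟩
  let N : ℕ := ∏ a ∈ S, (f a).den
  have hN : (N : ℚ) ≠ 0 := by
    rw [Nat.cast_ne_zero]; exact Finset.prod_ne_zero_iff.2 fun a _ => (f a).den_nz
  have hint : ∀ a ∈ S, ((⌊(N : ℚ) * f a⌋ : ℤ) : ℚ) = N * f a := by
    intro a ha
    obtain ⟨m, hm⟩ := Finset.dvd_prod_of_mem (fun a => (f a).den) ha
    have : (N : ℚ) * f a = ((m * (f a).num : ℤ) : ℚ) := by
      have h1 : (N : ℚ) = (f a).den * m := by exact_mod_cast hm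
      rw [h1]; push_cast
      rw [mul_right_comm, Rat.den_mul_eq_num, mul_comm]
    rw [this, Int.floor_intCast]
  refine ⟨fun a => ⌊(N : ℚ) * f a⌋, by simp, fun a ha h => ?_, fun a ha b hb hab => ?_⟩
  · have h1 := hint a ha
    have h : ⌊(N : ℚ) * f a⌋ = 0 := h
    rw [h, Int.cast_zero] at h1
    by_contra h0
    exact hf a (Finset.mem_filter.2 ⟨ha, h0⟩) ((mul_eq_zero.1 h1.symm).resolve_left hN)
  · have : ((⌊(N : ℚ) * f (a + b)⌋ : ℤ) : ℚ) = ((⌊(N : ℚ) * f a⌋ + ⌊(N : ℚ) * f b⌋ : ℤ) : ℚ) := by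
      rw [Int.cast_add, hint _ ha, hint _ hb, hint _ hab, map_add, mul_add]
    exact_mod_cast this

theorem pc_two {K : Type*} [Field K] [CharZero K] (n : ℤ) (h : ((2 : K) ^ n) ^ 2 = 1) : n = 0 := by
  have h1 : (((((2 : ℚ) ^ n) ^ 2 : ℚ)) : K) = ((1 : ℚ) : K) := by push_cast; exact h
  have h2 : ((2 : ℚ) ^ n) ^ 2 = 1 := by exact_mod_cast h1
  have h3 : (2 : ℚ) ^ n = 1 := by
    have : (0:ℚ) < 2 ^ n := by positivity
    nlinarith
  rwa [zpow_eq_one_iff_right₀ (by norm_num) (by norm_num)] at h3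

theorem pc_inv {K V : Type*} [Field K] [CharZero K] [AddCommGroup V] [Module K V] (M : Module.End K V) :
    ∀ (m : ℕ) (x : V), M (M x) = x → ((M - 1) ^ m) x = 0 → M x = x := by
  intro m
  induction m with
  | zero => intro x _ h; simp at h; simp [h]
  | succ m ih =>
    intro x hx h
    rw [pow_succ, Module.End.mul_apply] at h
    have h1 := ih ((M - 1) x) (by simp [hx]) h
    simp [hx] at h1
    have h2 : (2 : K) • (M x - x) = 0 := by
      rw [two_smul]
      calc M x - x + (M x - x) = (x - M x) + (M x - x) := by rw [h1]
        _ = 0 := by abel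
    rw [smul_eq_zero] at h2
    exact sub_eq_zero.1 (h2.resolve_left two_ne_zero)

variable {K L : Type*} [Field K] [IsAlgClosed K] [CharZero K] [LieRing L] [LieAlgebra K L]
  [FiniteDimensional K L] [LieAlgebra.IsKilling K L]

theorem pC (mu : L ≃ₗ⁅K⁆ L) (h2 : ∀ x, mu (mu x) = x)
    (hμ : mu.toLinearEquiv ∈ Subgroup.closure {e : L ≃ₗ[K] L | ∃ x, IsNilpotent (ad K L x) ∧
      (e : L →ₗ[K] L) = pX K L (ad K L x)}) :
    ∃ C : LieSubalgebra K L, C.IsCartanSubalgebra ∧ ∀ x ∈ C, mu x = x := by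
  classical
  obtain ⟨y, hmy, hys, hC, hmem⟩ := pB mu h2
  refine ⟨LieSubalgebra.engel K y, hC, ?_⟩
  set A := ad K L y with hA
  obtain ⟨e, e0, e1, e2⟩ := pc_int (pS A)
  let w : K → K := fun a => (2 : K) ^ (e a)
  have hw : ∀ a, w a ≠ 0 := fun a => zpow_ne_zero _ two_ne_zero
  obtain ⟨T, hT⟩ := pt y hys w hw (by
    intro a b ha hb hab
    simp only [w]
    rw [e2 a ha b hb hab, zpow_add₀ two_ne_zero])
  have hTv : ∀ a v, A v = a • v → T v = w a • v := fun a v hv => by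
    rw [hT, pT_apply _ _ _ _ hv]
  have hT0 : ∀ x, ⁅y, x⁆ = 0 → T x = x := by
    intro x hx
    rw [hTv 0 x (by simpa [hA] using hx)]; simp [w, e0]
  let w' : K → K := fun a => a / (w a ^ 2 - 1)
  let Q := pT A w'
  let T' : Module.End K L := pc T
  have hT' : ∀ a v, A v = a • v → T' v = w a • v := hTv
  have hQ : A = Q * (T' ^ 2 - 1) := by
    apply pss_ext A hys
    intro a v hv
    by_cases hv0 : v = 0
    · simp [hv0]
    have ha := pS_mem A a v hv hv0
    have h3 : (T' ^ 2 - 1 : Module.End K L) v = (w a ^ 2 - 1) • v := by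
      rw [LinearMap.sub_apply, pow_two, Module.End.mul_apply, hT' a v hv, map_smul, hT' a v hv, smul_smul,
        sub_smul, pow_two, one_smul]; rfl
    rw [Module.End.mul_apply, h3, map_smul, show Q v = w' a • v from pT_apply _ _ _ _ hv, hv, smul_smul]
    congr 1
    by_cases h4 : w a ^ 2 - 1 = 0
    · rw [h4, zero_mul]
      exact e1 a ha (pc_two (K := K) (e a) (sub_eq_zero.1 h4))
    · simp only [w']; field_simp
  have hQc : Commute Q (T' ^ 2 - 1) := by
    have : Commute Q T' := by
      apply pss_ext A hys
      intro a v hv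
      have h5 : Q v = w' a • v := pT_apply _ _ _ _ hv
      rw [Module.End.mul_apply, Module.End.mul_apply, hT' a v hv, h5, map_smul, map_smul, hT' a v hv, h5,
        smul_comm]
    exact (this.pow_right 2).sub_right (Commute.one_right Q)
  have heng : ∀ (m : ℕ) (x : L), ((T' ^ 2 - 1 : Module.End K L) ^ m) x = 0 → x ∈ LieSubalgebra.engel K y := by
    intro m x hx
    rw [LieSubalgebra.mem_engel_iff]
    refine ⟨m, ?_⟩
    rw [← hA, hQ, hQc.mul_pow, Module.End.mul_apply, hx, map_zero]
  have hfix : ∀ x, x ∈ LieSubalgebra.engel K y ↔ T x = x := by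
    intro x
    refine ⟨fun h => hT0 x ((hmem x).1 h), fun h => heng 1 x ?_⟩
    have h' : T' x = x := h
    rw [pow_one, LinearMap.sub_apply, pow_two, Module.End.mul_apply, h', h']; simp
  have hmT : Commute (pc mu) T' := by
    apply pss_ext A hys
    intro a v hv
    have h5 : A (mu v) = a • mu v := by
      have := congrArg mu hv
      rwa [hA, ad_apply, LieEquiv.map_lie, hmy, map_smul] at this
    rw [Module.End.mul_apply, Module.End.mul_apply, hT' a v hv, map_smul]
    exact (hT' a _ h5).symm
  let M : Module.End K L := pc mu * T'
  have hM2 : M ^ 2 = T' ^ 2 := by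
    have h6 : (pc mu) ^ 2 = 1 := by ext v; simp [pow_two, pc_apply, h2]
    rw [hmT.mul_pow, h6, one_mul]
  have hle : Module.End.maxGenEigenspace M 1 ≤ (LieSubalgebra.engel K y).toSubmodule ⊓ LinearMap.ker (pc mu - 1) := by
    intro x hx
    rw [Module.End.mem_maxGenEigenspace] at hx
    obtain ⟨m, hm⟩ := hx
    rw [one_smul] at hm
    have hxC : x ∈ LieSubalgebra.engel K y := by
      apply heng m
      have h7 : T' ^ 2 - 1 = (M + 1) * (M - 1) := by rw [← hM2]; noncomm_ring
      have h8 : Commute (M + 1) (M - 1) := by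
        show (M+1) * (M-1) = (M-1) * (M+1)
        noncomm_ring
      rw [h7, h8.mul_pow, Module.End.mul_apply, hm, map_zero]
    have hTx : T' x = x := (hfix x).1 hxC
    have hMM : M (M x) = x := by
      have := LinearMap.congr_fun hM2 x
      rw [pow_two, pow_two, Module.End.mul_apply (f := T'), hTx, hTx] at this
      exact this
    have hMx := pc_inv M m x hMM hm
    refine ⟨hxC, ?_⟩
    rw [SetLike.mem_coe, LinearMap.mem_ker, LinearMap.sub_apply, sub_eq_zero]
    rw [show M x = pc mu (T' x) from rfl, hTx] at hMx
    exact hMx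
  have hd := pA (finrank K (LieSubalgebra.engel K y)) mu.toLinearEquiv hμ T ⟨_, hC, rfl, hfix⟩
  have heq := Submodule.eq_of_le_of_finrank_le (hle.trans inf_le_left) hd
  intro x hx
  have hx' : x ∈ Module.End.maxGenEigenspace M 1 := by rw [heq]; exact hx
  have := (hle hx').2
  rw [SetLike.mem_coe, LinearMap.mem_ker, LinearMap.sub_apply, sub_eq_zero] at this
  exact this
end partC

end helpers

/-- Every inner involution of `g` is the product of two commuting
involutions of maximal rank. -/
theorem inner_involution_eq_product_of_commuting_maxRank (mu : g ≃ₗ⁅k⁆ g)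
    (hinner : IsInnerAut k g mu) (hinv : IsInvolution k g mu) :
    ∃ θ θ' : g ≃ₗ⁅k⁆ g, IsInvolution k g θ ∧ IsInvolution k g θ' ∧
      IsMaxRank k g θ ∧ IsMaxRank k g θ' ∧
      (∀ x, θ (θ' x) = θ' (θ x)) ∧ ∀ x, mu x = θ (θ' x) := by
  have hK : LieAlgebra.IsKilling k g := inferInstance
  obtain ⟨C, hC, hfix⟩ := pC mu hinv hinner
  obtain ⟨θ, θ', h1, h2, h3, h4, h5, h6⟩ := pe C mu hinv hfix
  have key : ∀ σ : g ≃ₗ⁅k⁆ g, (∀ x ∈ C, σ x = -x) → IsMaxRank k g σ := by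
    intro σ hσ
    refine ⟨C, hC, fun x hx => ?_⟩
    rw [eigSub, Module.End.mem_eigenspace_iff, neg_smul, one_smul]
    exact hσ x hx
  exact ⟨θ, θ', h1, h2, key θ h3, key θ' h4, h5, h6⟩
end

section
/- Let ϑ and ϑ' be commuting involutions of g, both of maximal rank, with quaternionic decomposition g = g₀₀ ⊕ g₀₁ ⊕ g₁₀ ⊕ g₁₁ (the first index records the ϑ-eigenvalue, the second the ϑ'-eigenvalue). Then dim g₁₀ = dim g₀₁, dim g₁₁ − dim g₀₀ equals the rank of g, and the restriction of ϑ to the fixed-point subalgebra g^{ϑϑ'} = g₀₀ ⊕ g₁₁ is an involution of maximal rank of g₀₀ ⊕ g₁₁, i.e., g₁₁ contains a Cartan subalgebra of g₀₀ ⊕ g₁₁. -/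
open LieAlgebra Module

variable (k : Type*) [Field k] [IsAlgClosed k] [CharZero k]
variable (g : Type*) [LieRing g] [LieAlgebra k g] [FiniteDimensional k g]
  [LieAlgebra.IsSemisimple k g]

set_option linter.unusedSectionVars false
section helpers
variable {k : Type*} [Field k] [IsAlgClosed k] [CharZero k]
variable {g : Type*} [LieRing g] [LieAlgebra k g] [FiniteDimensional k g]

theorem exists_grading_elt [IsKilling k g] (H : LieSubalgebra k g) [H.IsCartanSubalgebra] :
    ∃ h₀ ∈ H, (⨆ z : ℤ, (ad k g h₀).eigenspace (z : k)) = ⊤ ∧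
      ∀ x, ⁅h₀, x⁆ = 0 → x ∈ H := by
  obtain ⟨b⟩ := (IsKilling.rootSystem H).nonempty_base
  obtain ⟨F, hF⟩ := exists_dual_forall_apply_eq_one b.linearIndepOn_root
  obtain ⟨h₀, rfl⟩ := (Module.evalEquiv k H).surjective F
  have key (α : H.root) : (α : LieModule.Weight k H g) h₀ = ((b.height α : ℤ) : k) := by
    obtain ⟨f, -, -, hf⟩ := b.exists_root_eq_sum_int α
    rw [RootPairing.Base.height_eq_sum hf]
    have := congrArg (Module.evalEquiv k H h₀) hf
    rw [map_sum] at this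
    rw [Finset.sum_congr rfl (g := fun j => (f j : k))] at this
    · simpa using this
    · intro j hj
      rw [map_zsmul, hF j hj]; simp
  have hab : ∀ x ∈ H, ⁅(h₀ : g), x⁆ = 0 := by
    intro x hx
    have : ⁅h₀, (⟨x, hx⟩ : H)⁆ = 0 := trivial_lie_zero _ _ _ _
    simpa using congrArg (fun y : H => (y : g)) this
  have htop : (⊤ : Submodule k g) ≤ H.toSubmodule ⊔
      ⨆ z ∈ ({0}ᶜ : Set ℤ), (ad k g h₀).eigenspace (z : k) := by
    have := congrArg LieSubmodule.toSubmodule (LieModule.iSup_genWeightSpace_eq_top' k H g)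
    rw [LieSubmodule.iSup_toSubmodule] at this
    rw [LieSubmodule.top_toSubmodule] at this
    rw [← this]
    refine iSup_le fun α => ?_
    by_cases hα : α.IsZero
    · refine le_trans ?_ le_sup_left
      have h0 : (α : H → k) = 0 := hα
      intro x hx
      rw [h0] at hx
      have hx : x ∈ rootSpace H (0 : H → k) := hx
      rw [rootSpace_zero_eq] at hx
      simpa using hx
    · refine le_trans ?_ le_sup_right
      let α' : H.root := ⟨α, by simpa using hα⟩
      refine le_trans ?_ (le_iSup₂_of_le (b.height α') (b.height_ne_zero α') le_rfl)
      intro x hx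
      have := IsKilling.lie_eq_smul_of_mem_rootSpace (H := H) (α := α) hx h₀
      rw [Module.End.mem_eigenspace_iff, ← key α']
      exact this
  refine ⟨h₀, h₀.2, ?_, ?_⟩
  · rw [eq_top_iff]
    refine htop.trans (sup_le ?_ (iSup₂_le fun z _ => le_iSup (fun z : ℤ => (ad k g h₀).eigenspace (z : k)) z))
    refine le_trans ?_ (le_iSup _ (0:ℤ))
    intro x hx
    rw [Module.End.mem_eigenspace_iff]
    simpa using hab x hx
  · intro x hx
    obtain ⟨h, hh, ν, hν, rfl⟩ := Submodule.mem_sup.1 (htop (Submodule.mem_top (x := x)))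
    rw [lie_add, hab h hh, zero_add] at hx
    have ind := ((ad k g h₀).eigenspaces_iSupIndep.comp (Int.cast_injective (α := k)))
    have := ind.disjoint_biSup (y := {0}ᶜ) (x := 0) (by simp)
    have h0 : ν = 0 := by
      refine Submodule.disjoint_def.1 this ν ?_ hν
      simpa using hx
    simpa [h0] using hh

/-- sum of integral eigenspaces -/
noncomputable def FS (f : Module.End k g) (S : Set ℤ) : Submodule k g := ⨆ z ∈ S, f.eigenspace (z : k)

theorem FS_disj (f : Module.End k g) {S T : Set ℤ} (h : Disjoint S T) :
    Disjoint (FS f S) (FS f T) :=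
  ((f.eigenspaces_iSupIndep.comp (Int.cast_injective (α := k)))).disjoint_biSup_biSup h

theorem FS_union (f : Module.End k g) (S T : Set ℤ) : FS f (S ∪ T) = FS f S ⊔ FS f T :=
  iSup_union

theorem FS_mono (f : Module.End k g) {S T : Set ℤ} (h : S ⊆ T) : FS f S ≤ FS f T :=
  biSup_mono h

theorem FS_ind (f : Module.End k g) {S : Set ℤ} {p : g → Prop} 
   (h1 : ∀ z ∈ S, ∀ x, f x = (z : k) • x → p x) (h0 : p 0) (ha : ∀ x y, p x → p y → p (x + y))
   {x : g} (hx : x ∈ FS f S) : p x := by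
  unfold FS at hx
  rw [iSup_subtype'] at hx
  refine Submodule.iSup_induction _ (motive := p) hx ?_ h0 ha
  rintro ⟨z, hz⟩ x hx
  exact h1 z hz x (by simpa using Module.End.mem_eigenspace_iff.1 hx)

theorem mem_FS (f : Module.End k g) {S : Set ℤ} {z : ℤ} (hz : z ∈ S) {x : g}
    (h : f x = (z : k) • x) : x ∈ FS f S :=
  Submodule.mem_iSup_of_mem z (Submodule.mem_iSup_of_mem hz (Module.End.mem_eigenspace_iff.2 h))

theorem FS_lie (h : g) {S T U : Set ℤ} (hST : ∀ s ∈ S, ∀ t ∈ T, s + t ∈ U) {x y : g}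
    (hx : x ∈ FS (ad k g h) S) (hy : y ∈ FS (ad k g h) T) : ⁅x, y⁆ ∈ FS (ad k g h) U := by
  refine FS_ind _ (p := fun x => ⁅x, y⁆ ∈ FS (ad k g h) U) ?_ ?_ ?_ hx
  · intro z hz x hx
    refine FS_ind _ (p := fun y => ⁅x, y⁆ ∈ FS (ad k g h) U) ?_ ?_ ?_ hy
    · intro t ht y hy
      refine mem_FS _ (hST z hz t ht) ?_
      simp only [ad_apply] at *
      rw [leibniz_lie, hx, hy]
      simp [add_smul]
    · simp
    · intro a b ha hb; rw [lie_add]; exact add_mem ha hb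
  · simp
  · intro a b ha hb; rw [add_lie]; exact add_mem ha hb

theorem FS_kill (h : g) {S T : Set ℤ} (hST : ∀ s ∈ S, ∀ t ∈ T, s + t ≠ 0) {x y : g}
    (hx : x ∈ FS (ad k g h) S) (hy : y ∈ FS (ad k g h) T) : killingForm k g x y = 0 := by
  refine FS_ind _ (p := fun x => killingForm k g x y = 0) ?_ ?_ ?_ hx
  · intro z hz x hx
    refine FS_ind _ (p := fun y => killingForm k g x y = 0) ?_ ?_ ?_ hy
    · intro t ht y hy
      have := LieModule.traceForm_apply_lie_apply' k g g h x y
      simp only [ad_apply] at *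
      rw [hx, hy] at this
      have h2 : ((z + t : ℤ) : k) * killingForm k g x y = 0 := by
        simp only [map_smul, LinearMap.smul_apply, smul_eq_mul, killingForm] at *
        push_cast
        linear_combination this
      exact (mul_eq_zero.1 h2).resolve_left (by exact_mod_cast hST z hz t ht)
    · simp
    · intro a b ha hb; rw [map_add, ha, hb, add_zero]
  · simp
  · intro a b ha hb; rw [map_add, LinearMap.add_apply, ha, hb, add_zero]

theorem FS_nilp {h x : g} (htop : FS (ad k g h) Set.univ = ⊤)
    (hx : x ∈ FS (ad k g h) (Set.Ioi 0)) : IsNilpotent (ad k g x) := by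
  rw [Module.End.isNilpotent_iff_of_finite]
  have ind := ((ad k g h).eigenspaces_iSupIndep.comp (Int.cast_injective (α := k)))
  have hfin := WellFoundedGT.finite_ne_bot_of_iSupIndep ind
  obtain ⟨M, hM⟩ := hfin.bddAbove
  have hbot : ∀ z, M < z → FS (ad k g h) (Set.Ici z) = ⊥ := by
    intro z hz
    unfold FS
    rw [iSup₂_eq_bot]
    intro w hw
    by_contra hne
    have := hM (show w ∈ _ from hne)
    have : z ≤ w := hw
    omega
  have hpow : ∀ (m : ℕ) (z : ℤ) (y : g), y ∈ FS (ad k g h) (Set.Ici z) →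
      (ad k g x ^ m) y ∈ FS (ad k g h) (Set.Ici (z + m)) := by
    intro m
    induction m with
    | zero => intro z y hy; simpa using hy
    | succ m ih =>
      intro z y hy
      rw [pow_succ', Module.End.mul_apply, ad_apply]
      refine FS_lie h ?_ hx (ih z y hy)
      intro s hs t ht
      simp only [Set.mem_Ioi, Set.mem_Ici] at *
      push_cast
      omega
  intro y
  have hy : y ∈ FS (ad k g h) Set.univ := by rw [htop]; trivial
  refine FS_ind _ (p := fun y => ∃ m : ℕ, (ad k g x ^ m) y = 0) ?_ ⟨0, by simp⟩ ?_ hy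
  · intro z _ y hy
    refine ⟨(M + 1 - z).toNat, ?_⟩
    have := hpow (M + 1 - z).toNat z y (mem_FS _ (Set.mem_Ici.2 le_rfl) hy)
    rw [hbot _ (by omega)] at this
    simpa using this
  · rintro a b ⟨m, hm⟩ ⟨n, hn⟩
    refine ⟨m + n, ?_⟩
    have h1 : (ad k g x ^ (m + n)) a = 0 := by
      rw [add_comm m n, pow_add, Module.End.mul_apply, hm, map_zero]
    have h2 : (ad k g x ^ (m + n)) b = 0 := by
      rw [pow_add, Module.End.mul_apply, hn, map_zero]
    rw [map_add, h1, h2, add_zero]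

theorem FS_nilp_zero {h x ν : g} (htop : FS (ad k g h) Set.univ = ⊤)
    (hx : x ∈ FS (ad k g h) {0}) (hν : ν ∈ FS (ad k g h) (Set.Ioi 0))
    (hn : IsNilpotent (ad k g (x + ν))) : IsNilpotent (ad k g x) := by
  obtain ⟨m, hm⟩ := hn
  refine ⟨m, ?_⟩
  have key : ∀ (m : ℕ) (z : ℤ) (y : g), y ∈ FS (ad k g h) {z} →
      (ad k g x ^ m) y ∈ FS (ad k g h) {z} ∧
      (ad k g (x + ν) ^ m) y - (ad k g x ^ m) y ∈ FS (ad k g h) (Set.Ioi z) := by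
    intro m z y hy
    induction m with
    | zero => simpa using hy
    | succ m ih =>
      obtain ⟨h1, h2⟩ := ih
      simp only [pow_succ', Module.End.mul_apply, ad_apply]
      refine ⟨FS_lie h (by simp) hx h1, ?_⟩
      have : ⁅x + ν, (ad k g (x + ν) ^ m) y⁆ - ⁅x, (ad k g x ^ m) y⁆ =
        ⁅x + ν, (ad k g (x + ν) ^ m) y - (ad k g x ^ m) y⁆ + ⁅ν, (ad k g x ^ m) y⁆ := by
        simp only [lie_sub, add_lie]; abel
      rw [this]
      refine add_mem (FS_lie h (S := Set.Ici 0) ?_ (add_mem (FS_mono _ ?_ hx) (FS_mono _ ?_ hν)) h2) (FS_lie h ?_ hν h1)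
      · intro s hs t ht; simp only [Set.mem_Ioi, Set.mem_Ici] at *; omega
      · simp
      · exact Set.Ioi_subset_Ici_self
      · intro s hs t ht; simp only [Set.mem_Ioi, Set.mem_singleton_iff] at *; omega
  ext y
  have hy : y ∈ FS (ad k g h) Set.univ := by rw [htop]; trivial
  refine FS_ind _ (p := fun y => (ad k g x ^ m) y = (0 : Module.End k g) y) ?_ (by simp) ?_ hy
  · intro z _ y hy
    obtain ⟨h1, h2⟩ := key m z y (mem_FS _ (Set.mem_singleton z) hy)
    rw [hm] at h2
    rw [LinearMap.zero_apply, zero_sub, neg_mem_iff] at h2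
    exact Submodule.disjoint_def.1 (FS_disj (ad k g h) (S := {z}) (T := Set.Ioi z) (by simp)) _ h1 h2
  · intro a b ha hb
    rw [map_add, map_add, ha, hb]

theorem killing_nondeg [IsKilling k g] {x : g} (h : ∀ y, killingForm k g x y = 0) : x = 0 := by
  have : x ∈ LinearMap.ker (killingForm k g) := by
    ext y; exact h y
  rw [IsKilling.ker_killingForm_eq_bot] at this
  simpa using this

theorem exists_borel [IsKilling k g] (H : LieSubalgebra k g) [H.IsCartanSubalgebra] :
    ∃ b n : Submodule k g, b = H.toSubmodule ⊔ n ∧ Disjoint H.toSubmodule n ∧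
      (∀ x, (∀ y ∈ b, killingForm k g x y = 0) ↔ x ∈ n) ∧
      (∀ x ∈ n, IsNilpotent (ad k g x)) ∧ (∀ x ∈ b, IsNilpotent (ad k g x) → x ∈ n) ∧
      (∀ θ : g ≃ₗ⁅k⁆ g, (∀ h ∈ H, θ h = -h) → ∀ x ∈ n, θ x ∈ b → x = 0) := by
  obtain ⟨h, hH, htop, hcen⟩ := exists_grading_elt H
  replace htop : FS (ad k g h) Set.univ = ⊤ := by
    rw [← htop]; simp [FS]
  have hab : ∀ x ∈ H, ⁅h, x⁆ = 0 := by
    intro x hx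
    have : ⁅(⟨h, hH⟩ : H), (⟨x, hx⟩ : H)⁆ = 0 := trivial_lie_zero _ _ _ _
    simpa using congrArg (fun y : H => (y : g)) this
  have h0 : FS (ad k g h) {0} = H.toSubmodule := by
    ext x
    simp only [FS, Set.mem_singleton_iff, iSup_iSup_eq_left, Module.End.mem_eigenspace_iff]
    simp
    exact ⟨hcen x, hab x⟩
  have hb : FS (ad k g h) (Set.Ici 0) = H.toSubmodule ⊔ FS (ad k g h) (Set.Ioi 0) := by
    rw [← h0, ← FS_union]
    congr 1
    ext; simp
  have hall : FS (ad k g h) (Set.Ioi 0) ⊔ FS (ad k g h) (Set.Iic 0) = ⊤ := by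
    rw [← FS_union, ← htop]; congr 1; ext; simp
  refine ⟨FS (ad k g h) (Set.Ici 0), FS (ad k g h) (Set.Ioi 0), hb, ?_, ?_, ?_, ?_, ?_⟩
  · rw [← h0]; exact FS_disj _ (by simp)
  · intro x
    constructor
    · intro hx
      obtain ⟨u, hu, v, hv, rfl⟩ := Submodule.mem_sup.1 (show x ∈ _ ⊔ _ from hall ▸ Submodule.mem_top)
      have hK : ∀ y ∈ FS (ad k g h) (Set.Ici 0), killingForm k g u y = 0 := fun y hy =>
        FS_kill h (by intro s hs t ht; simp only [Set.mem_Ioi, Set.mem_Ici] at *; omega) hu hy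
      have : v = 0 := by
        refine killing_nondeg (k := k) fun y => ?_
        obtain ⟨a, ha, c, hc, rfl⟩ : ∃ a ∈ FS (ad k g h) (Set.Ici 0), ∃ c ∈ FS (ad k g h) (Set.Iio 0), a + c = y := by
          refine Submodule.mem_sup.1 ?_
          rw [← FS_union, show Set.Ici (0:ℤ) ∪ Set.Iio 0 = Set.univ by ext; simp, htop]; trivial
        have h1 := hx a ha
        rw [map_add, LinearMap.add_apply, hK a ha, zero_add] at h1
        rw [map_add, h1, zero_add]
        exact FS_kill h (by intro s hs t ht; simp only [Set.mem_Iic, Set.mem_Iio] at *; omega) hv hc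
      simpa [this] using hu
    · intro hx y hy
      exact FS_kill h (by intro s hs t ht; simp only [Set.mem_Ioi, Set.mem_Ici] at *; omega) hx hy
  · exact fun x hx => FS_nilp htop hx
  · intro x hx hn
    rw [hb] at hx
    obtain ⟨u, hu, v, hv, rfl⟩ := Submodule.mem_sup.1 hx
    have := FS_nilp_zero htop (h0 ▸ hu) hv hn
    have := IsKilling.eq_zero_of_isNilpotent_ad_of_mem_isCartanSubalgebra k g H hu this
    simpa [this] using hv
  · intro θ hθ x hx hxb
    have : θ x ∈ FS (ad k g h) (Set.Iio 0) := by
      refine FS_ind _ (p := fun x => θ x ∈ FS (ad k g h) (Set.Iio 0)) ?_ ?_ ?_ hx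
      · intro z hz x hx
        refine mem_FS _ (z := -z) (by simpa using hz) ?_
        have h1 := congrArg θ hx
        simp only [ad_apply, LieEquiv.map_lie, hθ h hH] at h1 ⊢
        rw [show θ ((z : k) • x) = (z : k) • θ x from map_smul θ.toLinearEquiv _ _] at h1
        push_cast
        rw [neg_lie] at h1
        rw [neg_smul, ← h1, neg_neg]
      · simp
      · intro a b ha hb; rw [map_add]; exact add_mem ha hb
    have := Submodule.disjoint_def.1 (FS_disj (ad k g h) (S := Set.Iio 0) (T := Set.Ici 0) (by simp)) _ this hxb
    exact (map_eq_zero_iff θ θ.injective).1 this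


theorem borel_dims [IsKilling k g] {H : LieSubalgebra k g} {b n : Submodule k g}
    (hb : b = H.toSubmodule ⊔ n) (hd : Disjoint H.toSubmodule n)
    (ho : ∀ x, (∀ y ∈ b, killingForm k g x y = 0) ↔ x ∈ n) :
    finrank k b = finrank k H + finrank k n ∧ finrank k n + finrank k b = finrank k g := by
  constructor
  · have := Submodule.finrank_sup_add_finrank_inf_eq H.toSubmodule n
    rw [hd.eq_bot, finrank_bot, ← hb] at this
    exact this
  · have hn : n = (killingForm k g).orthogonal b := by
      ext x
      rw [← ho, LinearMap.BilinForm.mem_orthogonal_iff]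
      refine forall₂_congr fun y hy => ?_
      rw [LieModule.traceForm_comm]
    have h1 := LinearMap.BilinForm.finrank_orthogonal (IsKilling.killingForm_nondegenerate k g) b
    rw [← hn] at h1
    have := Submodule.finrank_le b
    omega

theorem cartan_finrank_le [IsKilling k g] (H C : LieSubalgebra k g) [H.IsCartanSubalgebra]
    [C.IsCartanSubalgebra] : finrank k C ≤ finrank k H := by
  obtain ⟨b₁, n₁, hb₁, hd₁, ho₁, hn₁, hm₁, -⟩ := exists_borel H
  obtain ⟨b₂, n₂, hb₂, hd₂, ho₂, hn₂, hm₂, -⟩ := exists_borel C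
  obtain ⟨e₁, f₁⟩ := borel_dims hb₁ hd₁ ho₁
  obtain ⟨e₂, f₂⟩ := borel_dims hb₂ hd₂ ho₂
  have hnd := IsKilling.killingForm_nondegenerate k g
  have hrefl := (LieModule.traceForm_isSymm k g g).isRefl
  have horth : ∀ {b n : Submodule k g}, (∀ x, (∀ y ∈ b, killingForm k g x y = 0) ↔ x ∈ n) →
      (killingForm k g).orthogonal n ≤ b := by
    intro b n ho x hx
    rw [← LinearMap.BilinForm.orthogonal_orthogonal hnd hrefl b]
    rw [LinearMap.BilinForm.mem_orthogonal_iff] at hx ⊢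
    intro y hy
    refine hx y ((ho y).1 fun z hz => ?_)
    rw [LinearMap.BilinForm.mem_orthogonal_iff] at hy
    rw [LieModule.traceForm_comm]
    exact hy z hz
  have h1 : (killingForm k g).orthogonal (n₁ ⊔ n₂) ≤ b₁ ⊓ b₂ :=
    le_inf ((LinearMap.BilinForm.orthogonal_le le_sup_left).trans (horth ho₁))
      ((LinearMap.BilinForm.orthogonal_le le_sup_right).trans (horth ho₂))
  have h2 := Submodule.finrank_mono h1
  rw [LinearMap.BilinForm.finrank_orthogonal hnd] at h2
  have h3 := Submodule.finrank_sup_add_finrank_inf_eq n₁ n₂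
  have h4 := Submodule.finrank_sup_add_finrank_inf_eq (b₁ ⊓ b₂) n₁
  have h5 : (b₁ ⊓ b₂) ⊓ n₁ ≤ n₁ ⊓ n₂ := by
    rintro x ⟨⟨hx1, hx2⟩, hx3⟩
    exact ⟨hx3, hm₂ x hx2 (hn₁ x hx3)⟩
  have h5 := Submodule.finrank_mono h5
  have h6 : (b₁ ⊓ b₂) ⊔ n₁ ≤ b₁ := sup_le inf_le_left (hb₁ ▸ le_sup_right)
  have h6 := Submodule.finrank_mono h6
  omega

theorem mem_eigSub {σ : g ≃ₗ⁅k⁆ g} {c : k} {x : g} : x ∈ eigSub k g σ c ↔ σ x = c • x := by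
  unfold eigSub
  rw [Module.End.mem_eigenspace_iff]; rfl

theorem inv_dims [IsKilling k g] (H : LieSubalgebra k g) [H.IsCartanSubalgebra]
    (θ : g ≃ₗ⁅k⁆ g) (hθ : IsInvolution k g θ) (hH : H.toSubmodule ≤ eigSub k g θ (-1)) :
    2 * finrank k (eigSub k g θ 1) + finrank k H = finrank k g := by
  obtain ⟨b, n, hb, hd, ho, hn, hm, hT⟩ := exists_borel H
  obtain ⟨e, f⟩ := borel_dims hb hd ho
  have hH' : ∀ h ∈ H, θ h = -h := fun h hh => by simpa using mem_eigSub.1 (hH hh)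
  have hT := hT θ hH'
  have hnb : n ≤ b := hb ▸ le_sup_right
  have hHb : H.toSubmodule ≤ b := hb ▸ le_sup_left
  have h1 : eigSub k g θ 1 ⊓ b = ⊥ := by
    rw [eq_bot_iff]
    rintro x ⟨hx1, hx2⟩
    rw [SetLike.mem_coe, mem_eigSub, one_smul] at hx1
    rw [SetLike.mem_coe, hb] at hx2
    obtain ⟨h, hh, ν, hν, rfl⟩ := Submodule.mem_sup.1 hx2
    rw [map_add, hH' h hh] at hx1
    have h2 : θ ν = h + h + ν := by
      rw [neg_add_eq_iff_eq_add] at hx1; rw [hx1]; abel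
    have h3 : ν = 0 := by
      refine hT ν hν ?_
      rw [h2]
      exact add_mem (add_mem (hHb hh) (hHb hh)) (hnb hν)
    rw [h3] at h2 ⊢
    have : (2 : k) • h = 0 := by rw [two_smul]; simpa using h2.symm
    have := (smul_eq_zero.1 this).resolve_left two_ne_zero
    simp [this]
  have h2 := Submodule.finrank_sup_add_finrank_inf_eq (eigSub k g θ 1) b
  rw [h1, finrank_bot] at h2
  have h3 := Submodule.finrank_le (eigSub k g θ 1 ⊔ b)
  have h4 : finrank k n ≤ finrank k (eigSub k g θ 1) := by
    let F : n →ₗ[k] eigSub k g θ 1 := LinearMap.codRestrict _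
      ((LinearMap.id + (θ.toLinearEquiv : g →ₗ[k] g)).comp n.subtype) (by
        intro x
        rw [mem_eigSub]
        change θ ((x : g) + θ x) = (1 : k) • ((x : g) + θ x)
        rw [map_add, hθ, one_smul, add_comm])
    refine LinearMap.finrank_le_finrank_of_injective (f := F) ?_
    rw [injective_iff_map_eq_zero]
    intro x hx
    have hx : (x : g) + θ x = 0 := congrArg Subtype.val hx
    have : θ x = -(x : g) := by rw [eq_neg_iff_add_eq_zero, add_comm]; exact hx
    have := hT x x.2 (by rw [this]; exact neg_mem (hnb x.2))
    exact Subtype.ext this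
  omega

theorem split_dims (σ : g ≃ₗ⁅k⁆ g) (hσ : IsInvolution k g σ) (W : Submodule k g)
    (hW : ∀ x ∈ W, σ x ∈ W) : finrank k (W ⊓ eigSub k g σ 1 : Submodule k g) +
      finrank k (W ⊓ eigSub k g σ (-1) : Submodule k g) = finrank k W := by
  have h2 := Submodule.finrank_sup_add_finrank_inf_eq (W ⊓ eigSub k g σ 1) (W ⊓ eigSub k g σ (-1))
  have h3 : (W ⊓ eigSub k g σ 1) ⊓ (W ⊓ eigSub k g σ (-1)) = ⊥ := by
    rw [eq_bot_iff]
    rintro x ⟨⟨-, h1⟩, ⟨-, h2⟩⟩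
    rw [SetLike.mem_coe, mem_eigSub] at h1 h2
    rw [h1, one_smul, neg_smul, one_smul, eq_neg_iff_add_eq_zero, ← two_smul k] at h2
    exact (smul_eq_zero.1 h2).resolve_left two_ne_zero
  have h4 : (W ⊓ eigSub k g σ 1) ⊔ (W ⊓ eigSub k g σ (-1)) = W := by
    refine le_antisymm (sup_le inf_le_left inf_le_left) fun x hx => ?_
    refine Submodule.mem_sup.2 ⟨(2⁻¹ : k) • (x + σ x), ⟨W.smul_mem _ (add_mem hx (hW x hx)), ?_⟩,
      (2⁻¹ : k) • (x - σ x), ⟨W.smul_mem _ (sub_mem hx (hW x hx)), ?_⟩, ?_⟩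
    · rw [SetLike.mem_coe, mem_eigSub, map_smul, map_add, hσ, one_smul, add_comm]
    · rw [SetLike.mem_coe, mem_eigSub, map_smul, map_sub, hσ, neg_smul, one_smul, ← smul_neg, neg_sub]
    · rw [← smul_add, add_add_sub_cancel, ← two_smul k, smul_smul, inv_mul_cancel₀ two_ne_zero, one_smul]
  rw [h3, finrank_bot, h4] at h2
  omega


open Module.End in
theorem jordan [IsKilling k g] (y : g) : ∃ s n : g, y = s + n ∧ (ad k g s).IsSemisimple ∧
    IsNilpotent (ad k g n) ∧ (∀ z : g, ⁅y, z⁆ = 0 → ⁅s, z⁆ = 0) := by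
  obtain ⟨N, -, S, hS₀, hN, hS, hSN⟩ := (ad k g y).exists_isNilpotent_isSemisimple
  replace hS₀ : Commute (ad k g y) S := Algebra.commute_of_mem_adjoin_self hS₀
  have hN' := hN
  rw [eq_sub_of_add_eq hSN.symm] at hN
  have aux {μ : k} {z : g} (hz : z ∈ (ad k g y).maxGenEigenspace μ) : S z = μ • z := by
    rw [maxGenEigenspace_eq] at hz
    exact apply_eq_of_mem_of_comm_of_isFinitelySemisimple_of_isNil hz hS₀ hS.isFinitelySemisimple hN
  have h_der (u v : g) (α β : k) (hu : u ∈ (ad k g y).maxGenEigenspace α)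
      (hv : v ∈ (ad k g y).maxGenEigenspace β) : S ⁅u, v⁆ = ⁅S u, v⁆ + ⁅u, S v⁆ := by
    have huv : ⁅u, v⁆ ∈ (ad k g y).maxGenEigenspace (α + β) :=
      LieModule.lie_mem_maxGenEigenspace_toEnd hu hv
    rw [aux hu, aux hv, aux huv, smul_lie, lie_smul, ← add_smul]
  replace h_der (u v : g) : S ⁅u, v⁆ = ⁅S u, v⁆ + ⁅u, S v⁆ := by
    have hu : u ∈ ⨆ α : k, (ad k g y).maxGenEigenspace α := by
      rw [iSup_maxGenEigenspace_eq_top]; trivial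
    have hv : v ∈ ⨆ α : k, (ad k g y).maxGenEigenspace α := by
      rw [iSup_maxGenEigenspace_eq_top]; trivial
    induction hu using Submodule.iSup_induction' with
    | mem α u hu =>
      induction hv using Submodule.iSup_induction' with
      | mem β v hv => exact h_der u v α β hu hv
      | zero => simp
      | add _ _ _ _ h h' => simp only [lie_add, map_add, h, h']; abel
    | zero => simp
    | add _ _ _ _ h h' => simp only [add_lie, map_add, h, h']; abel
  replace h_der : ∀ u v : g, S ⁅u, v⁆ = ⁅u, S v⁆ - ⁅v, S u⁆ := by
    simp_rw [← lie_skew (S _) _, add_comm, ← sub_eq_add_neg] at h_der; assumption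
  let S' : LieDerivation k g g := ⟨S, h_der⟩
  obtain ⟨s, hs⟩ := LieDerivation.IsKilling.exists_eq_ad S'
  replace hs : S = ad k g s := by rw [← LieDerivation.coe_ad_apply_eq_ad_apply s, hs]
  refine ⟨s, y - s, by abel, hs ▸ hS, ?_, fun z hz => ?_⟩
  · rw [map_sub, ← hs]; exact hN
  · have : z ∈ (ad k g y).maxGenEigenspace 0 := by
      rw [mem_maxGenEigenspace]
      exact ⟨1, by simpa using hz⟩
    have := aux this
    rw [hs, zero_smul] at this
    simpa using this

theorem ad_inj [IsKilling k g] {x y : g} (h : ad k g x = ad k g y) : x = y := by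
  rw [← sub_eq_zero]
  refine killing_nondeg (k := k) fun z => ?_
  rw [killingForm_apply_apply, map_sub, h, sub_self]
  simp

theorem ad_ss_map (θ : g ≃ₗ⁅k⁆ g) {s : g} (h : (ad k g s).IsSemisimple) :
    (ad k g (θ s)).IsSemisimple := by
  refine (LinearEquiv.isSemisimple_iff (ad k g s) (ad k g (θ s)) θ.toLinearEquiv ?_).1 h
  ext z
  simpa using LieEquiv.map_lie θ s z

theorem ad_nilp_map (θ : g ≃ₗ⁅k⁆ g) {s : g} (h : IsNilpotent (ad k g s)) :
    IsNilpotent (ad k g (θ s)) := by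
  rw [← conj_ad_apply]
  obtain ⟨n, hn⟩ := h
  refine ⟨n, ?_⟩
  have h1 : ∀ m, (θ.toLinearEquiv.conj (ad k g s)) ^ m = θ.toLinearEquiv.conj (ad k g s ^ m) := by
    generalize ad k g s = f
    intro m
    induction m with
    | zero => ext z; simp
    | succ m ih => 
      rw [pow_succ, ih, pow_succ]
      ext z
      simp only [Module.End.mul_apply, LinearEquiv.conj_apply_apply, LinearEquiv.symm_apply_apply]
  rw [h1, hn, map_zero]

theorem commute_ad {s n : g} (h : ⁅s, n⁆ = 0) : Commute (ad k g s) (ad k g n) := by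
  ext z
  simp only [Module.End.mul_apply, ad_apply]
  rw [leibniz_lie, h, zero_lie, zero_add]

theorem jordan_neg [IsKilling k g] {y s n : g} (θ : g ≃ₗ⁅k⁆ g) (hy : θ y = -y) (h : y = s + n)
    (hs : (ad k g s).IsSemisimple) (hn : IsNilpotent (ad k g n)) (hsn : ⁅s, n⁆ = 0) :
    θ s = -s ∧ θ n = -n := by
  have h1 : Commute (ad k g n) (ad k g s) := (commute_ad hsn).symm
  have h2 : Commute (ad k g (-θ n)) (ad k g (-θ s)) := by
    refine (commute_ad ?_).symm
    rw [neg_lie, lie_neg, neg_neg, ← LieEquiv.map_lie, hsn, map_zero]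
  have h3 := Module.End.isNilpotent_isSemisimple_unique hn hs
    (n₂ := ad k g (-θ n)) (s₂ := ad k g (-θ s)) (by rw [map_neg]; exact (ad_nilp_map θ hn).neg)
    (by rw [map_neg]; exact Module.End.isSemisimple_neg.2 (ad_ss_map θ hs)) h1 h2 (by
      rw [← map_add, ← map_add, ← neg_add, ← map_add, add_comm, ← h, hy, neg_neg])
  have h4 := ad_inj h3.1
  have h5 := ad_inj h3.2
  exact ⟨by rw [eq_neg_iff_add_eq_zero]; nth_rw 2 [h5]; simp,
    by rw [eq_neg_iff_add_eq_zero]; nth_rw 2 [h4]; simp⟩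

theorem kill_nilp {x n : g} (h : ⁅x, n⁆ = 0) (hn : IsNilpotent (ad k g n)) :
    killingForm k g x n = 0 := by
  rw [killingForm_apply_apply]
  exact (LinearMap.isNilpotent_trace_of_isNilpotent
    ((commute_ad h).isNilpotent_mul_left hn)).eq_zero

theorem kill_inv (θ : g ≃ₗ⁅k⁆ g) (x y : g) :
    killingForm k g (θ x) (θ y) = killingForm k g x y := killingForm_of_equiv_apply θ x y

theorem ss_disj {f : Module.End k g} (hf : f.IsSemisimple) {v : g} (h : f (f v) = 0) : f v = 0 := by
  have h1 := hf.isFinitelySemisimple.genEigenspace_eq_eigenspace 0 (k := 2) (by simp)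
  have : v ∈ f.genEigenspace 0 (2 : ℕ) := by
    rw [Module.End.mem_genEigenspace_nat]
    simpa [pow_two] using h
  have : v ∈ f.genEigenspace 0 2 := this
  rw [h1, Module.End.mem_eigenspace_iff] at this
  simpa using this

theorem ss_span {f : Module.End k g} (hf : f.IsSemisimple) :
    LinearMap.ker f ⊔ LinearMap.range f = ⊤ := by
  have h1 : LinearMap.ker f ⊓ LinearMap.range f = ⊥ := by
    rw [eq_bot_iff]
    rintro _ ⟨h, v, rfl⟩
    exact ss_disj hf h
  have h2 := Submodule.finrank_sup_add_finrank_inf_eq (LinearMap.ker f) (LinearMap.range f)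
  have h3 := LinearMap.finrank_range_add_finrank_ker f
  rw [h1, finrank_bot] at h2
  exact Submodule.eq_top_of_finrank_eq (by omega)

theorem generic {f e : Module.End k g} (hf : f.IsSemisimple) (hc : Commute f e) :
    ∃ t : k, LinearMap.ker (e + t • f) ≤ LinearMap.ker f := by
  have hfin : Set.Finite ((fun p : k × k => - p.1 / p.2) ''
      ({μ | e.HasEigenvalue μ} ×ˢ {μ | f.HasEigenvalue μ})) :=
    ((Module.End.finite_hasEigenvalue e).prod (Module.End.finite_hasEigenvalue f)).image _
  obtain ⟨t, ht⟩ := hfin.exists_notMem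
  refine ⟨t, ?_⟩
  set W := LinearMap.ker (e + t • f)
  have hW : ∀ x ∈ W, f x ∈ W := by
    intro x hx
    have hx : (e + t • f) x = 0 := hx
    have hc' : Commute f (e + t • f) := hc.add_right ((Commute.refl f).smul_right t)
    have := LinearMap.congr_fun hc'.eq x
    simp only [Module.End.mul_apply, hx, map_zero] at this
    exact this.symm
  have h0 : f.restrict hW = 0 := by
    rw [(hf.restrict hW).eq_zero_iff_forall_eigenvalue]
    intro μ hμ
    by_contra hne
    obtain ⟨v, hv⟩ := hμ.exists_hasEigenvector
    have h1 : f v = μ • (v : g) := congrArg Subtype.val hv.apply_eq_smul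
    have hv0 : (v : g) ≠ 0 := fun h => hv.2 (Subtype.ext h)
    have h2 : (e + t • f) v = 0 := v.2
    have h3 : e v = (-(t * μ)) • (v : g) := by
      rw [LinearMap.add_apply, LinearMap.smul_apply, h1, smul_smul] at h2
      rw [neg_smul, eq_neg_iff_add_eq_zero, h2]
    refine ht ⟨(-(t * μ), μ), ⟨Module.End.hasEigenvalue_of_hasEigenvector
      ⟨Module.End.mem_eigenspace_iff.2 h3, hv0⟩, Module.End.hasEigenvalue_of_hasEigenvector
      ⟨Module.End.mem_eigenspace_iff.2 h1, hv0⟩⟩, ?_⟩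
    simp only [neg_neg]
    field_simp
  intro x hx
  exact congrArg Subtype.val (LinearMap.congr_fun h0 ⟨x, hx⟩)

theorem exists_min (θ θ' : g ≃ₗ⁅k⁆ g) : ∃ x : g, (θ x = -x ∧ θ' x = -x) ∧
    (ad k g x).IsSemisimple ∧ ∀ y : g, (θ y = -y ∧ θ' y = -y) → (ad k g y).IsSemisimple →
      ⁅x, y⁆ = 0 → ∀ z : g, ⁅x, z⁆ = 0 → ⁅y, z⁆ = 0 := by
  obtain ⟨x, ⟨hx, hxs⟩, hmin⟩ := WellFounded.has_min
    (InvImage.wf (fun x : g => finrank k (LinearMap.ker (ad k g x))) wellFounded_lt)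
    {x : g | (θ x = -x ∧ θ' x = -x) ∧ (ad k g x).IsSemisimple}
    ⟨0, ⟨by simp, by simp⟩, by rw [map_zero]; exact Module.End.isSemisimple_zero⟩
  refine ⟨x, hx, hxs, fun y hy hys hxy z hz => ?_⟩
  have hc := commute_ad (k := k) hxy
  obtain ⟨t, ht⟩ := generic (e := ad k g y) hxs hc
  have e1 : ad k g (y + t • x) = ad k g y + t • ad k g x := by rw [map_add, map_smul]
  have h1 := hmin (y + t • x) ⟨⟨by rw [map_add, map_smul, hx.1, hy.1, smul_neg, neg_add],
    by rw [map_add, map_smul, hx.2, hy.2, smul_neg, neg_add]⟩, by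
      rw [e1]
      exact Module.End.IsSemisimple.add_of_commute (hc.symm.smul_right t) hys
        (Module.End.IsSemisimple_smul t hxs)⟩
  have h1 : finrank k (LinearMap.ker (ad k g x)) ≤ finrank k (LinearMap.ker (ad k g (y + t • x))) :=
    not_lt.1 h1
  rw [e1] at h1
  have h2 := Submodule.eq_of_le_of_finrank_le ht h1
  have hz1 : z ∈ LinearMap.ker (ad k g x) := hz
  have hz2 := hz1
  rw [← h2] at hz2
  have hz3 : ⁅y, z⁆ + t • ⁅x, z⁆ = 0 := hz2
  rwa [hz, smul_zero, add_zero] at hz3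

theorem neg_central [IsKilling k g] (θ θ' : g ≃ₗ⁅k⁆ g) (hcomm : CommutingInvolutions k g θ θ')
    {x : g} (hx : θ x = -x ∧ θ' x = -x) (hxs : (ad k g x).IsSemisimple)
    (hmin : ∀ y : g, (θ y = -y ∧ θ' y = -y) → (ad k g y).IsSemisimple →
      ⁅x, y⁆ = 0 → ∀ z : g, ⁅x, z⁆ = 0 → ⁅y, z⁆ = 0)
    {y : g} (hy : θ y = -y ∧ θ' y = -y) (hxy : ⁅x, y⁆ = 0) (z : g) (hz : ⁅x, z⁆ = 0) :
    ⁅y, z⁆ = 0 := by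
  have J : ∀ y : g, (θ y = -y ∧ θ' y = -y) → ⁅x, y⁆ = 0 → ∃ s n : g, y = s + n ∧
      (θ s = -s ∧ θ' s = -s) ∧ (θ n = -n ∧ θ' n = -n) ∧ ⁅x, n⁆ = 0 ∧
      IsNilpotent (ad k g n) ∧ ∀ z : g, ⁅x, z⁆ = 0 → ⁅s, z⁆ = 0 := by
    intro y hy hxy
    obtain ⟨s, n, h, hs, hn, hc⟩ := jordan (k := k) y
    have hsx : ⁅x, s⁆ = 0 := by
      rw [← lie_skew, hc x (by rw [← lie_skew, hxy, neg_zero]), neg_zero]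
    have hsn : ⁅s, n⁆ = 0 := by
      have := hc y (lie_self y)
      rwa [h, lie_add, lie_self, zero_add] at this
    have hnx : ⁅x, n⁆ = 0 := by
      rwa [h, lie_add, hsx, zero_add] at hxy
    have j1 := jordan_neg θ hy.1 h hs hn hsn
    have j2 := jordan_neg θ' hy.2 h hs hn hsn
    exact ⟨s, n, h, ⟨j1.1, j2.1⟩, ⟨j1.2, j2.2⟩, hnx, hn,
      hmin s ⟨j1.1, j2.1⟩ hs hsx⟩
  have A0 : ∀ n : g, (θ n = -n ∧ θ' n = -n) → ⁅x, n⁆ = 0 → IsNilpotent (ad k g n) →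
      ∀ m : g, (θ m = -m ∧ θ' m = -m) → ⁅x, m⁆ = 0 → IsNilpotent (ad k g m) →
      killingForm k g m n = 0 := by
    intro n hn hxn hnn m hm hxm hnm
    obtain ⟨s, p, h, -, -, hxp, hpn, hsc⟩ := J (m + n)
      ⟨by rw [map_add, hn.1, hm.1, neg_add], by rw [map_add, hn.2, hm.2, neg_add]⟩
      (by rw [lie_add, hxm, hxn, add_zero])
    have e1 := kill_nilp (hsc n hxn) hnn
    have e2 := kill_nilp (hsc m hxm) hnm
    have e3 := kill_nilp (hsc p hxp) hpn
    have e4 := kill_nilp (lie_self p) hpn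
    have e5 := kill_nilp (lie_self n) hnn
    have e6 := kill_nilp (lie_self m) hnm
    have f1 : killingForm k g s (m + n) = 0 := by rw [map_add, e1, e2, add_zero]
    have f2 : killingForm k g (m + n) p = 0 := by
      rw [h, map_add, LinearMap.add_apply, e3, e4, add_zero]
    have f3 : killingForm k g (m + n) (m + n) = 0 := by
      nth_rw 2 [h]
      rw [map_add, f2, LieModule.traceForm_comm, f1, add_zero]
    rw [map_add (killingForm k g), LinearMap.add_apply, map_add, map_add, e5, e6,
      LieModule.traceForm_comm k g g n m, zero_add, add_zero, ← two_mul] at f3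
    exact (mul_eq_zero.1 f3).resolve_left two_ne_zero
  have A1 : ∀ n : g, (θ n = -n ∧ θ' n = -n) → ⁅x, n⁆ = 0 → IsNilpotent (ad k g n) →
      ∀ w : g, (θ w = -w ∧ θ' w = -w) → ⁅x, w⁆ = 0 → killingForm k g w n = 0 := by
    intro n hn hxn hnn w hw hxw
    obtain ⟨s, p, h, -, hp, hxp, hpn, hsc⟩ := J w hw hxw
    rw [h, map_add, LinearMap.add_apply, kill_nilp (hsc n hxn) hnn,
      A0 n hn hxn hnn p hp hxp hpn, add_zero]
  have red : ∀ (σ : g ≃ₗ⁅k⁆ g), σ x = -x → ∀ n : g, σ n = -n → ∀ w : g, ⁅x, w⁆ = 0 →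
      ⁅x, w - σ w⁆ = 0 ∧ killingForm k g (w - σ w) n = 2 * killingForm k g w n := by
    intro σ hσ n hn w hw
    constructor
    · have : ⁅x, σ w⁆ = 0 := by
        have h1 := LieEquiv.map_lie σ x w
        rw [hw, map_zero, hσ, neg_lie] at h1
        exact neg_eq_zero.1 h1.symm
      rw [lie_sub, hw, this, sub_zero]
    · have h1 := kill_inv (k := k) σ w n
      rw [hn, map_neg] at h1
      rw [map_sub, LinearMap.sub_apply, ← h1]
      ring_nf
  have A2 : ∀ n : g, (θ n = -n ∧ θ' n = -n) → ⁅x, n⁆ = 0 → IsNilpotent (ad k g n) → n = 0 := by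
    intro n hn hxn hnn
    refine killing_nondeg (k := k) fun v => ?_
    rw [LieModule.traceForm_comm]
    have hv : v ∈ LinearMap.ker (ad k g x) ⊔ LinearMap.range (ad k g x) := by
      rw [ss_span hxs]; trivial
    obtain ⟨w, hw, _, ⟨u, rfl⟩, rfl⟩ := Submodule.mem_sup.1 hv
    have hw : ⁅x, w⁆ = 0 := hw
    obtain ⟨r1, r2⟩ := red θ hx.1 n hn.1 w hw
    obtain ⟨r3, r4⟩ := red θ' hx.2 n hn.2 _ r1
    have r5 := A1 n hn hxn hnn (w - θ w - θ' (w - θ w)) ⟨by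
      simp only [map_sub, hcomm.1 w, hcomm.2.2]
      abel, by
      simp only [map_sub, hcomm.2.1 w, hcomm.2.1 (θ w)]; abel⟩ r3
    rw [r4, r2] at r5
    have r6 := (mul_eq_zero.1 ((mul_eq_zero.1 r5).resolve_left two_ne_zero)).resolve_left two_ne_zero
    rw [map_add, LinearMap.add_apply]
    have r7 : killingForm k g (ad k g x u) n = 0 := by
      rw [ad_apply, ← lie_skew, map_neg, LinearMap.neg_apply, LieModule.traceForm_apply_lie_apply,
        hxn, map_zero, neg_zero]
    rw [r7, add_zero]
    exact r6
  obtain ⟨s, n, h, -, hn, hxn, hnn, hsc⟩ := J y hy hxy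
  rw [h, A2 n hn hxn hnn, add_zero]
  exact hsc z hz

theorem central_dim [IsKilling k g] (H : LieSubalgebra k g) [H.IsCartanSubalgebra] {x : g}
    (hxs : (ad k g x).IsSemisimple) (Z : Submodule k g) (hZ : ∀ z ∈ Z, ⁅x, z⁆ = 0)
    (hZ' : ∀ z ∈ Z, ∀ w : g, ⁅x, w⁆ = 0 → ⁅z, w⁆ = 0) : finrank k Z ≤ finrank k H := by
  have : Infinite k := IsAlgClosed.instInfinite
  obtain ⟨c, hc⟩ := exists_isCartanSubalgebra_engel k (zg k g x)
  set C := LieSubalgebra.engel k c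
  have hcen : ∀ z (hz : ⁅x, z⁆ = 0), (∀ w : g, ⁅x, w⁆ = 0 → ⁅z, w⁆ = 0) →
      (⟨z, hz⟩ : zg k g x) ∈ C := by
    intro z hz hzc
    rw [← hc.self_normalizing, LieSubalgebra.mem_normalizer_iff]
    intro y hy
    have : ⁅(⟨z, hz⟩ : zg k g x), y⁆ = 0 := Subtype.ext (hzc y y.2)
    rw [this]; exact zero_mem _
  let D : LieSubalgebra k g := C.map (zg k g x).incl
  have hinj : Function.Injective (zg k g x).incl := Subtype.val_injective
  have hD : ∀ y, y ∈ D ↔ ∃ h : ⁅x, y⁆ = 0, (⟨y, h⟩ : zg k g x) ∈ C := by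
    intro y
    rw [LieSubalgebra.mem_map]
    constructor
    · rintro ⟨y, hy, rfl⟩
      exact ⟨y.2, hy⟩
    · rintro ⟨h, hy⟩
      exact ⟨_, hy, rfl⟩
  have hxD : x ∈ D := (hD x).2 ⟨lie_self x, hcen x _ fun w hw => hw⟩
  have : D.IsCartanSubalgebra := by
    refine ⟨?_, ?_⟩
    · exact (LieEquiv.nilpotent_iff_equiv_nilpotent (C.equivMapOfInjective _ hinj)).1 hc.nilpotent
    · refine le_antisymm (fun y hy => ?_) (LieSubalgebra.le_normalizer D)
      rw [LieSubalgebra.mem_normalizer_iff'] at hy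
      have h1 := hy x hxD
      have h2 : ⁅x, y⁆ = 0 := ss_disj hxs ((hD _).1 h1).1
      refine (hD y).2 ⟨h2, ?_⟩
      rw [← hc.self_normalizing, LieSubalgebra.mem_normalizer_iff']
      intro w hw
      exact ((hD _).1 (hy w ((hD _).2 ⟨w.2, hw⟩))).2
  refine le_trans (Submodule.finrank_mono (t := D.toSubmodule) fun z hz => ?_)
    (cartan_finrank_le H D)
  exact (hD z).2 ⟨hZ z hz, hcen z _ (hZ' z hz)⟩

theorem map_dims (f : Module.End k g) (A : Submodule k g) :
    finrank k (A.map f) + finrank k (A ⊓ LinearMap.ker f : Submodule k g) = finrank k A := by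
  have h := LinearMap.finrank_range_add_finrank_ker (f.domRestrict A)
  rw [LinearMap.range_domRestrict] at h
  rw [← h, add_right_inj]
  have : A ⊓ LinearMap.ker f = (LinearMap.ker (f.domRestrict A)).map A.subtype := by
    ext z
    simp only [Submodule.mem_inf, LinearMap.mem_ker, Submodule.mem_map, Submodule.subtype_apply]
    constructor
    · rintro ⟨h1, h2⟩; exact ⟨⟨z, h1⟩, h2, rfl⟩
    · rintro ⟨y, h1, rfl⟩; exact ⟨y.2, h1⟩
  rw [this]
  exact Submodule.finrank_map_subtype_eq _ _

theorem swap_dims {f : Module.End k g} (hf : f.IsSemisimple) {A B : Submodule k g}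
    (h : A.map f ≤ B) : finrank k (A.map f) ≤ finrank k (B.map f) := by
  have h1 := map_dims f (A.map f)
  have h2 : A.map f ⊓ LinearMap.ker f = ⊥ := by
    rw [eq_bot_iff]
    rintro _ ⟨⟨y, -, rfl⟩, hy⟩
    exact ss_disj hf hy
  rw [h2, finrank_bot] at h1
  have h3 := Submodule.finrank_mono (Submodule.map_mono (f := f) h)
  omega

theorem mem_q11 {θ θ' : g ≃ₗ⁅k⁆ g} {y : g} :
    y ∈ qSpace k g θ θ' true true ↔ θ y = -y ∧ θ' y = -y := by
  unfold qSpace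
  rw [Submodule.mem_inf, mem_eigSub, mem_eigSub]
  simp

theorem mem_q00 {θ θ' : g ≃ₗ⁅k⁆ g} {y : g} :
    y ∈ qSpace k g θ θ' false false ↔ θ y = y ∧ θ' y = y := by
  unfold qSpace
  rw [Submodule.mem_inf, mem_eigSub, mem_eigSub]
  simp

theorem part12 [IsKilling k g] (θ θ' : g ≃ₗ⁅k⁆ g) (hcomm : CommutingInvolutions k g θ θ')
    (H H' : LieSubalgebra k g) [H.IsCartanSubalgebra] [H'.IsCartanSubalgebra]
    (hH : H.toSubmodule ≤ eigSub k g θ (-1)) (hH' : H'.toSubmodule ≤ eigSub k g θ' (-1)) :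
    finrank k (qSpace k g θ θ' true false) = finrank k (qSpace k g θ θ' false true) ∧
      finrank k (qSpace k g θ θ' true true) =
        finrank k (qSpace k g θ θ' false false) + finrank k H := by
  have a1 := inv_dims H θ hcomm.1 hH
  have a2 := inv_dims H' θ' hcomm.2.1 hH'
  have a3 := cartan_finrank_le H H'
  have a4 := cartan_finrank_le H' H
  have inv : ∀ c, ∀ x ∈ eigSub k g θ c, θ' x ∈ eigSub k g θ c := by
    intro c x hx
    rw [mem_eigSub] at hx ⊢
    rw [hcomm.2.2, hx, map_smul]
  have inv' : ∀ c, ∀ x ∈ eigSub k g θ' c, θ x ∈ eigSub k g θ' c := by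
    intro c x hx
    rw [mem_eigSub] at hx ⊢
    rw [← hcomm.2.2, hx, map_smul]
  have b1 := split_dims θ' hcomm.2.1 _ (inv 1)
  have b2 := split_dims θ' hcomm.2.1 _ (inv (-1))
  have b3 := split_dims θ hcomm.1 _ (inv' 1)
  have b4 := split_dims θ hcomm.1 ⊤ (fun _ _ => trivial)
  rw [inf_comm, inf_comm (eigSub k g θ' 1)] at b3
  rw [top_inf_eq, top_inf_eq, finrank_top] at b4
  have c1 : qSpace k g θ θ' true false = eigSub k g θ (-1) ⊓ eigSub k g θ' 1 := by simp [qSpace]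
  have c2 : qSpace k g θ θ' false true = eigSub k g θ 1 ⊓ eigSub k g θ' (-1) := by simp [qSpace]
  have c3 : qSpace k g θ θ' true true = eigSub k g θ (-1) ⊓ eigSub k g θ' (-1) := by simp [qSpace]
  have c4 : qSpace k g θ θ' false false = eigSub k g θ 1 ⊓ eigSub k g θ' 1 := by simp [qSpace]
  rw [c1, c2, c3, c4]
  omega

theorem part3 [IsKilling k g] (θ θ' : g ≃ₗ⁅k⁆ g) (hcomm : CommutingInvolutions k g θ θ')
    (H : LieSubalgebra k g) [H.IsCartanSubalgebra]
    (hdim : finrank k (qSpace k g θ θ' true true) =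
        finrank k (qSpace k g θ θ' false false) + finrank k H) :
    ∃ H : LieSubalgebra k (fixSubalgebra k g (θ'.trans θ)), H.IsCartanSubalgebra ∧
      ∀ y ∈ H, (y : g) ∈ qSpace k g θ θ' true true := by
  obtain ⟨x, hx, hxs, hmin⟩ := exists_min (k := k) θ θ'
  have hcen := fun (y : g) (hy : θ y = -y ∧ θ' y = -y) (hxy : ⁅x, y⁆ = 0) =>
    neg_central θ θ' hcomm hx hxs hmin hy hxy
  have d1 := central_dim H hxs (qSpace k g θ θ' true true ⊓ LinearMap.ker (ad k g x))
    (fun z hz => hz.2) (fun z hz => hcen z (mem_q11.1 hz.1) hz.2)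
  have d2 := map_dims (ad k g x) (qSpace k g θ θ' true true)
  have d3 := map_dims (ad k g x) (qSpace k g θ θ' false false)
  have d4 := swap_dims hxs (A := qSpace k g θ θ' true true) (B := qSpace k g θ θ' false false) (by
    rintro _ ⟨y, hy, rfl⟩
    have hy := mem_q11.1 hy
    rw [mem_q00, ad_apply, LieEquiv.map_lie, LieEquiv.map_lie, hx.1, hx.2, hy.1, hy.2]
    simp)
  have d5 := swap_dims hxs (A := qSpace k g θ θ' false false) (B := qSpace k g θ θ' true true) (by
    rintro _ ⟨y, hy, rfl⟩
    have hy := mem_q00.1 hy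
    rw [mem_q11, ad_apply, LieEquiv.map_lie, LieEquiv.map_lie, hx.1, hx.2, hy.1, hy.2]
    simp)
  have d6 : finrank k (qSpace k g θ θ' false false ⊓ LinearMap.ker (ad k g x) : Submodule k g) = 0 := by
    omega
  rw [Submodule.finrank_eq_zero] at d6
  have key : ∀ y : g, θ (θ' y) = y → ⁅x, y⁆ = 0 → θ y = -y ∧ θ' y = -y := by
    intro y hy hxy
    have e1 : θ' y = θ y := by rw [← hcomm.1 (θ' y), hy]
    have h1 := LieEquiv.map_lie θ x y
    rw [hxy, map_zero, hx.1, neg_lie] at h1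
    have h1 := neg_eq_zero.1 h1.symm
    have h2 : y + θ y ∈ qSpace k g θ θ' false false ⊓ LinearMap.ker (ad k g x) := by
      refine ⟨mem_q00.2 ⟨?_, ?_⟩, ?_⟩
      · rw [map_add, hcomm.1, add_comm]
      · rw [map_add, ← e1, hcomm.2.1, add_comm]
      · change ⁅x, y + θ y⁆ = 0
        rw [lie_add, hxy, h1, add_zero]
    rw [d6, Submodule.mem_bot] at h2
    rw [e1]
    have := eq_neg_of_add_eq_zero_right h2
    exact ⟨this, this⟩
  let x' : fixSubalgebra k g (θ'.trans θ) := ⟨x, by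
    change θ (θ' x) = x
    rw [hx.2, map_neg, hx.1, neg_neg]⟩
  have hz : ∀ y : fixSubalgebra k g (θ'.trans θ), y ∈ zg k _ x' ↔ ⁅x, (y : g)⁆ = 0 :=
    fun y => Subtype.ext_iff
  have hq : ∀ y ∈ zg k _ x', θ (y : g) = -y ∧ θ' (y : g) = -y := fun y hy =>
    key y y.2 ((hz y).1 hy)
  refine ⟨zg k _ x', ⟨?_, ?_⟩, fun y hy => mem_q11.2 (hq y hy)⟩
  · have : IsLieAbelian (zg k _ x') := ⟨fun a b => Subtype.ext (Subtype.ext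
      (hcen _ (hq a a.2) ((hz _).1 a.2) _ ((hz _).1 b.2)))⟩
    infer_instance
  · refine le_antisymm (fun y hy => ?_) (LieSubalgebra.le_normalizer _)
    rw [LieSubalgebra.mem_normalizer_iff'] at hy
    have h1 := (hz _).1 (hy x' ((hz _).2 (lie_self x)))
    exact (hz y).2 (ss_disj hxs h1)
end helpers

/-- For commuting involutions `θ, θ'` of maximal rank with quaternionic
decomposition `g = g₀₀ ⊕ g₀₁ ⊕ g₁₀ ⊕ g₁₁`: `dim g₁₀ = dim g₀₁`,
`dim g₁₁ - dim g₀₀` equals the rank of `g`, and `g₁₁` contains a Cartan subalgebra of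
the fixed-point subalgebra `g^{θθ'} = g₀₀ ⊕ g₁₁`. -/
theorem quaternionic_maxRank_dims (θ θ' : g ≃ₗ⁅k⁆ g)
    (hcomm : CommutingInvolutions k g θ θ')
    (h1 : IsMaxRank k g θ) (h2 : IsMaxRank k g θ') :
    Module.finrank k (qSpace k g θ θ' true false) =
      Module.finrank k (qSpace k g θ θ' false true) ∧
    (∃ H : LieSubalgebra k g, H.IsCartanSubalgebra ∧
      Module.finrank k (qSpace k g θ θ' true true) =
        Module.finrank k (qSpace k g θ θ' false false) + Module.finrank k H) ∧
    (∃ H : LieSubalgebra k (fixSubalgebra k g (θ'.trans θ)), H.IsCartanSubalgebra ∧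
      ∀ y ∈ H, (y : g) ∈ qSpace k g θ θ' true true) := by
  obtain ⟨H, hH, hH1⟩ := h1
  obtain ⟨H', hH', hH2⟩ := h2
  obtain ⟨p1, p2⟩ := part12 θ θ' hcomm H H' hH1 hH2
  exact ⟨p1, ⟨H, hH, p2⟩, part3 θ θ' hcomm H p2⟩
end
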